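/- For every ε > 0 there exists a constant C > 0 such that the following holds: for every prime p, every natural number N < p, and all finite sets P of points and L of lines in the plane F_p² with |P| ≤ N and |L| ≤ N, the number of incidences satisfies I(P,L) ≤ C · N^(3/2 − 1/662 + ε). -/

import Mathlib

open scoped Classical

/-- A line in the plane `F²`: the zero set of a nontrivial linear equation. -/
def IsLine {F : Type*} [CommRing F] (l : Set (F × F)) : Prop :=
  ∃ a b c : F, (a, b) ≠ ((0 : F), (0 : F)) ∧ l = {p : F × F | a * p.1 + b * p.2 + c = 0}

/-- The number of incidences between a finite set of points and a finite set of lines. -/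
noncomputable def incidences {α : Type*} (P : Finset α) (L : Finset (Set α)) : ℕ :=
  ((P ×ˢ L).filter fun q => q.1 ∈ q.2).card


/-- Number of edges of a bipartite relation. -/
noncomputable def ec {α β : Type*} (r : α → β → Prop) (U : Finset α) (V : Finset β) : ℕ :=
  ∑ u ∈ U, (V.filter (fun v => r u v)).card

lemma ec_comm {α β : Type*} (r : α → β → Prop) (U : Finset α) (V : Finset β) :
    ec r U V = ∑ v ∈ V, (U.filter (fun u => r u v)).card := by
  unfold ec
  exact Finset.sum_card_bipartiteAbove_eq_sum_card_bipartiteBelow r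

lemma ec_eq_card {α β : Type*} (r : α → β → Prop) (U : Finset α) (V : Finset β) :
    ec r U V = ((U ×ˢ V).filter (fun q => r q.1 q.2)).card := by
  unfold ec
  rw [Finset.card_filter, Finset.sum_product]
  simp only [Finset.card_filter]

lemma ec_erase_left {α β : Type*} (r : α → β → Prop) (U : Finset α) (V : Finset β) (u : α)
    (hu : u ∈ U) : ec r (U.erase u) V + (V.filter (fun v => r u v)).card = ec r U V := by
  unfold ec
  exact Finset.sum_erase_add _ _ hu

lemma ec_erase_right {α β : Type*} (r : α → β → Prop) (U : Finset α) (V : Finset β) (v : β)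
    (hv : v ∈ V) : ec r U (V.erase v) + (U.filter (fun u => r u v)).card = ec r U V := by
  rw [ec_comm, ec_comm]
  exact Finset.sum_erase_add _ _ hv

lemma prune {α β : Type*} (r : α → β → Prop) (U : Finset α) (V : Finset β) (a b : ℝ) :
    ∃ U' ⊆ U, ∃ V' ⊆ V, (∀ u ∈ U', a ≤ (V'.filter (fun v => r u v)).card) ∧
      (∀ v ∈ V', b ≤ (U'.filter (fun u => r u v)).card) ∧
      (ec r U V : ℝ) - a * U.card - b * V.card ≤ ec r U' V' - a * U'.card - b * V'.card := by
  obtain ⟨⟨U', V'⟩, hm, hmax⟩ := Finset.exists_max_image (U.powerset ×ˢ V.powerset)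
    (fun q : Finset α × Finset β => (ec r q.1 q.2 : ℝ) - a * q.1.card - b * q.2.card)
    ⟨(U, V), by simp⟩
  simp only [Finset.mem_product, Finset.mem_powerset] at hm hmax
  refine ⟨U', hm.1, V', hm.2, ?_, ?_, hmax (U, V) ⟨subset_rfl, subset_rfl⟩⟩
  · intro u hu
    have h1 := hmax (U'.erase u, V') ⟨(Finset.erase_subset _ _).trans hm.1, hm.2⟩
    have h2 := ec_erase_left r U' V' u hu
    have h3 := Finset.card_erase_add_one hu
    simp only at h1
    rw [← h2, ← h3] at h1
    push_cast at h1
    linarith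
  · intro v hv
    have h1 := hmax (U', V'.erase v) ⟨hm.1, (Finset.erase_subset _ _).trans hm.2⟩
    have h2 := ec_erase_right r U' V' v hv
    have h3 := Finset.card_erase_add_one hv
    simp only at h1
    rw [← h2, ← h3] at h1
    push_cast at h1
    linarith

lemma greedy_step {α β : Type*} (r : α → β → Prop) (U : Finset α) (V : Finset β) (Δ D : ℕ)
    (hΔ : 2 * (D + 1) ≤ Δ) (hdeg : ∀ v ∈ V, Δ ≤ (U.filter (fun u => r u v)).card)
    (w : β → ℝ) (hw : ∀ v, 0 ≤ w v) (S : Finset α) (hS : S ⊆ U)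
    (hbad : 2 * ∑ v ∈ V.filter (fun v => D + 1 ≤ (S.filter (fun u => r u v)).card), w v
      < ∑ v ∈ V, w v) :
    ∃ i ∈ U, i ∉ S ∧ (∑ v ∈ V, w v) * Δ + 4 * U.card *
        ∑ v ∈ V, w v * (min (D + 1) (S.filter (fun u => r u v)).card : ℕ) ≤
      4 * U.card * ∑ v ∈ V, w v * (min (D + 1) ((insert i S).filter (fun u => r u v)).card : ℕ) := by
  set W := ∑ v ∈ V, w v with hW
  set Df := V.filter (fun v => ¬ (D + 1 ≤ (S.filter (fun u => r u v)).card)) with hDf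
  have hsplit := Finset.sum_filter_add_sum_filter_not V
    (fun v => D + 1 ≤ (S.filter (fun u => r u v)).card) w
  have hWd : W < 2 * ∑ v ∈ Df, w v := by rw [hDf]; linarith
  have hW0 : 0 < W := lt_of_le_of_lt (mul_nonneg (by norm_num) (Finset.sum_nonneg fun v _ => hw v)) hbad
  have hΔ0 : (2 : ℝ) ≤ Δ := by exact_mod_cast (by omega : 2 ≤ Δ)
  -- double counting
  have hdc : ∑ i ∈ U \ S, ∑ v ∈ Df.filter (fun v => r i v), w v
      = ∑ v ∈ Df, w v * ((U \ S).filter (fun u => r u v)).card := by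
    simp only [Finset.sum_filter]
    rw [Finset.sum_comm]
    refine Finset.sum_congr rfl fun v _ => ?_
    rw [← Finset.sum_filter, Finset.sum_const, nsmul_eq_mul, mul_comm]
  have hlow : W * Δ / 4 ≤ ∑ i ∈ U \ S, ∑ v ∈ Df.filter (fun v => r i v), w v := by
    rw [hdc]
    calc W * Δ / 4 ≤ (∑ v ∈ Df, w v) * (Δ / 2) := by nlinarith
      _ = ∑ v ∈ Df, w v * (Δ / 2) := by rw [Finset.sum_mul]
      _ ≤ _ := by
        refine Finset.sum_le_sum fun v hv => mul_le_mul_of_nonneg_left ?_ (hw v)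
        rw [hDf, Finset.mem_filter] at hv
        have h1 := hdeg v hv.1
        have h2 : (U.filter (fun u => r u v)).card ≤
            ((U \ S).filter (fun u => r u v)).card + (S.filter (fun u => r u v)).card := by
          refine (Finset.card_le_card ?_).trans (Finset.card_union_le _ _)
          intro x hx
          simp only [Finset.mem_union, Finset.mem_filter, Finset.mem_sdiff] at hx ⊢
          tauto
        have h3 : Δ ≤ 2 * ((U \ S).filter (fun u => r u v)).card := by omega
        have h4 : (Δ : ℝ) ≤ 2 * ((U \ S).filter (fun u => r u v)).card := by exact_mod_cast h3
        linarith
  have hne : (U \ S).Nonempty := by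
    rw [Finset.nonempty_iff_ne_empty]
    intro h0
    rw [h0, Finset.sum_empty] at hlow
    nlinarith
  have hU : (0 : ℝ) < U.card := by
    have : 0 < U.card := Finset.card_pos.mpr (hne.mono Finset.sdiff_subset)
    exact_mod_cast this
  obtain ⟨i, hi, hi2⟩ := Finset.exists_le_of_sum_le (s := U \ S)
    (f := fun _ => W * Δ / (4 * U.card)) (g := fun i => ∑ v ∈ Df.filter (fun v => r i v), w v)
    hne (by
      rw [Finset.sum_const, nsmul_eq_mul]
      refine le_trans ?_ hlow
      have : ((U \ S).card : ℝ) ≤ U.card := by exact_mod_cast Finset.card_le_card Finset.sdiff_subset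
      calc ((U \ S).card : ℝ) * (W * Δ / (4 * U.card)) ≤ U.card * (W * Δ / (4 * U.card)) := by
            apply mul_le_mul_of_nonneg_right this; positivity
        _ = W * Δ / 4 := by field_simp)
  rw [Finset.mem_sdiff] at hi
  refine ⟨i, hi.1, hi.2, ?_⟩
  have hgain : ∑ v ∈ V, w v * (min (D + 1) (S.filter (fun u => r u v)).card : ℕ)
      + ∑ v ∈ Df.filter (fun v => r i v), w v ≤
      ∑ v ∈ V, w v * (min (D + 1) ((insert i S).filter (fun u => r u v)).card : ℕ) := by
    rw [hDf, Finset.filter_filter, Finset.sum_filter, ← Finset.sum_add_distrib]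
    refine Finset.sum_le_sum fun v hv => ?_
    have hc : (S.filter (fun u => r u v)).card ≤ ((insert i S).filter (fun u => r u v)).card :=
      Finset.card_le_card (Finset.filter_subset_filter _ (Finset.subset_insert _ _))
    split_ifs with hc2
    · have h5 : ((insert i S).filter (fun u => r u v)).card = (S.filter (fun u => r u v)).card + 1 := by
        rw [Finset.filter_insert, if_pos hc2.2, Finset.card_insert_of_notMem]
        simp [hi.2]
      rw [h5]
      have h6 : min (D + 1) ((S.filter (fun u => r u v)).card + 1)
        = min (D + 1) (S.filter (fun u => r u v)).card + 1 := by omega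
      rw [h6]; push_cast; linarith
    · rw [add_zero]
      refine mul_le_mul_of_nonneg_left ?_ (hw v)
      exact_mod_cast min_le_min le_rfl hc
  have h7 : W * Δ ≤ 4 * U.card * ∑ v ∈ Df.filter (fun v => r i v), w v := by
    rw [div_le_iff₀ (by positivity)] at hi2
    linarith
  nlinarith

lemma greedy {α β : Type*} (r : α → β → Prop) (U : Finset α) (V : Finset β) (Δ D h : ℕ)
    (hΔ : 2 * (D + 1) ≤ Δ) (hdeg : ∀ v ∈ V, Δ ≤ (U.filter (fun u => r u v)).card)
    (w : β → ℝ) (hw : ∀ v, 0 ≤ w v) (hh : 4 * (D + 1) * U.card < h * Δ) :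
    ∃ S ⊆ U, S.card ≤ h ∧ ∑ v ∈ V, w v ≤
      2 * ∑ v ∈ V.filter (fun v => D + 1 ≤ (S.filter (fun u => r u v)).card), w v := by
  by_contra hcon
  push Not at hcon
  have key : ∀ m ≤ h, ∃ S ⊆ U, S.card ≤ m ∧ (m : ℝ) * Δ * (∑ v ∈ V, w v) ≤ 4 * U.card *
        ∑ v ∈ V, w v * (min (D + 1) (S.filter (fun u => r u v)).card : ℕ) := by
    intro m
    induction m with
    | zero => intro _; exact ⟨∅, by simp, by simp, by simp⟩
    | succ m ih =>
      intro hm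
      obtain ⟨S, hS, hc, hg⟩ := ih (by omega)
      obtain ⟨i, hi, hiS, h1⟩ := greedy_step r U V Δ D hΔ hdeg w hw S hS (hcon S hS (by omega))
      refine ⟨insert i S, Finset.insert_subset hi hS, ?_, ?_⟩
      · rw [Finset.card_insert_of_notMem hiS]; omega
      · push_cast at h1 hg ⊢
        linarith
  obtain ⟨S, hS, hc, hg⟩ := key h le_rfl
  have hbad := hcon S hS hc
  have hW0 : 0 < ∑ v ∈ V, w v :=
    lt_of_le_of_lt (mul_nonneg (by norm_num) (Finset.sum_nonneg fun v _ => hw v)) hbad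
  have h2 : ∑ v ∈ V, w v * (min (D + 1) (S.filter (fun u => r u v)).card : ℕ) ≤
      (∑ v ∈ V, w v) * (D + 1) := by
    rw [Finset.sum_mul]
    refine Finset.sum_le_sum fun v _ => mul_le_mul_of_nonneg_left ?_ (hw v)
    exact_mod_cast min_le_left _ _
  have h3 : (4 * (D + 1) * U.card : ℝ) < h * Δ := by exact_mod_cast hh
  have h4 : (4 * U.card : ℝ) * ∑ v ∈ V, w v * (min (D + 1) (S.filter (fun u => r u v)).card : ℕ) ≤
    4 * U.card * ((∑ v ∈ V, w v) * (D + 1)) := mul_le_mul_of_nonneg_left h2 (by positivity)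
  nlinarith


section PolyDim
open MvPolynomial

lemma finrank_vdeg (F : Type*) [Field F] (k : ℕ) :
    6 * Module.finrank F (restrictTotalDegree (Fin 3) F k) = (k + 1) * (k + 2) * (k + 3) := by
  have h1 : Module.finrank F (restrictTotalDegree (Fin 3) F k) =
      Nat.card {n : Fin 3 →₀ ℕ | (n.sum fun _ e => e) ≤ k} :=
    Module.finrank_eq_nat_card_basis (basisRestrictSupport F _)
  have h2 : {n : Fin 3 →₀ ℕ | (n.sum fun _ e => e) ≤ k} =
      (((Finset.range (k + 1)).biUnion fun m => (Finset.univ : Finset (Fin 3)).finsuppAntidiag m :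
        Finset (Fin 3 →₀ ℕ)) : Set (Fin 3 →₀ ℕ)) := by
    ext n
    have : (n.sum fun _ e => e) = ∑ i, n i := Finsupp.sum_fintype _ _ (by simp)
    simp only [Set.mem_ofPred_eq, this, Finset.coe_biUnion, Set.mem_iUnion, Finset.mem_coe,
      Finset.mem_finsuppAntidiag, Finset.mem_range]
    constructor
    · intro h
      exact ⟨_, Nat.lt_succ_of_le h, rfl, Finset.subset_univ _⟩
    · rintro ⟨m, hm, h, -⟩
      have h' : ∑ i, n i = m := h
      omega
  rw [h1, h2]
  have h3 : Nat.card (((Finset.range (k + 1)).biUnion fun m =>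
      (Finset.univ : Finset (Fin 3)).finsuppAntidiag m : Finset (Fin 3 →₀ ℕ)) : Set (Fin 3 →₀ ℕ)) =
      ∑ m ∈ Finset.range (k + 1), (m + 2).choose 2 := by
    rw [Nat.card_coe_set_eq, Set.ncard_coe_finset, Finset.card_biUnion]
    · refine Finset.sum_congr rfl fun m _ => ?_
      rw [Finset.card_finsuppAntidiag_nat_eq_choose]
      simp only [Finset.card_univ, Fintype.card_fin]
      rw [show 3 + m - 1 = m + 2 by omega]
      exact Nat.choose_symm_add
    · intro a _ b _ hab
      rw [Function.onFun, Finset.disjoint_left]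
      intro n hn hn'
      rw [Finset.mem_finsuppAntidiag] at hn hn'
      exact hab (hn.1.symm.trans hn'.1)
  rw [h3]
  clear h1 h2 h3
  induction k with
  | zero => simp
  | succ k ih =>
    rw [Finset.sum_range_succ, mul_add, ih]
    have : 2 * (k + 1 + 2).choose 2 = (k + 3) * (k + 2) := by
      have := Nat.triangle_succ (k + 2)
      rw [Nat.choose_two_right]
      have h := Nat.div_mul_cancel (Nat.even_mul_pred_self (k + 1 + 2)).two_dvd
      rw [mul_comm, h]
      rfl
    nlinarith

/-- Restriction of a polynomial to the ray with parameters `(t,v,w)`. -/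
noncomputable def rho {F : Type*} [Field F] (τ : F × F × F) :
    MvPolynomial (Fin 3) F →ₐ[F] Polynomial F :=
  aeval ![Polynomial.X, Polynomial.C τ.1 * Polynomial.X + Polynomial.C τ.2.1,
    Polynomial.C (τ.1 ^ 2) * Polynomial.X + Polynomial.C (τ.1 * τ.2.1 + τ.2.2)]

@[simp] lemma rho_X0 {F : Type*} [Field F] (τ : F × F × F) : rho τ (X 0) = Polynomial.X := by
  simp [rho]
@[simp] lemma rho_X1 {F : Type*} [Field F] (τ : F × F × F) :
    rho τ (X 1) = Polynomial.C τ.1 * Polynomial.X + Polynomial.C τ.2.1 := by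
  simp [rho]
@[simp] lemma rho_X2 {F : Type*} [Field F] (τ : F × F × F) : rho τ (X 2) =
    Polynomial.C (τ.1 ^ 2) * Polynomial.X + Polynomial.C (τ.1 * τ.2.1 + τ.2.2) := by
  simp [rho]
@[simp] lemma rho_C {F : Type*} [Field F] (τ : F × F × F) (a : F) :
    rho τ (C a) = Polynomial.C a := by
  simp [rho]

lemma rho_natDegree {F : Type*} [Field F] (τ : F × F × F) (G : MvPolynomial (Fin 3) F) :
    (rho τ G).natDegree ≤ G.totalDegree := by
  unfold rho
  refine (MvPolynomial.aeval_natDegree_le G (m := G.totalDegree) le_rfl _ (n := 1) ?_).trans (by simp)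
  intro i
  fin_cases i
  · simp
  · exact Polynomial.natDegree_linear_le (a := τ.1) (b := τ.2.1)
  · exact Polynomial.natDegree_linear_le (a := τ.1 ^ 2) (b := τ.1 * τ.2.1 + τ.2.2)

lemma interpolate {F : Type*} [Field F] (S : Finset (F × F × F)) (D : ℕ)
    (h : 6 * (S.card * (D + 1)) < (D + 1) * (D + 2) * (D + 3)) :
    ∃ G : MvPolynomial (Fin 3) F, G ≠ 0 ∧ G.totalDegree ≤ D ∧ ∀ τ ∈ S, rho τ G = 0 := by
  let Ψ : restrictTotalDegree (Fin 3) F D →ₗ[F] (S × Fin (D + 1) → F) :=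
    LinearMap.pi fun q => (Polynomial.lcoeff F q.2.1) ∘ₗ (rho q.1.1).toLinearMap ∘ₗ
      (restrictTotalDegree (Fin 3) F D).subtype
  have hlt : Module.finrank F (S × Fin (D + 1) → F) <
      Module.finrank F (restrictTotalDegree (Fin 3) F D) := by
    rw [Module.finrank_fintype_fun_eq_card, Fintype.card_prod, Fintype.card_coe, Fintype.card_fin]
    have := finrank_vdeg F D
    omega
  have hk := LinearMap.ker_ne_bot_of_finrank_lt (f := Ψ) hlt
  obtain ⟨G, hG, hG0⟩ := (Submodule.ne_bot_iff _).mp hk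
  refine ⟨G.1, by simpa using hG0, (mem_restrictTotalDegree _ _ _).mp G.2, ?_⟩
  intro τ hτ
  ext a
  by_cases ha : a ≤ D
  · have := congrFun (LinearMap.mem_ker.mp hG) (⟨τ, hτ⟩, ⟨a, by omega⟩)
    simpa [Ψ] using this
  · have h1 := rho_natDegree τ G.1
    have h2 := (mem_restrictTotalDegree _ _ _).mp G.2
    rw [Polynomial.coeff_eq_zero_of_natDegree_lt (by omega)]
    simp

lemma exists_plane {F : Type*} [Field F] (σ τ : F × F × F) (h : σ ≠ τ) :
    ∃ A : MvPolynomial (Fin 3) F, A.totalDegree ≤ 1 ∧ rho σ A = 0 ∧ rho τ A ≠ 0 := by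
  by_cases h1 : σ.1 = τ.1 ∧ σ.2.1 = τ.2.1
  · refine ⟨X 2 - C (σ.1 ^ 2) * X 0 - C (σ.1 * σ.2.1 + σ.2.2), ?_, ?_, ?_⟩
    · refine (totalDegree_sub _ _).trans (max_le ((totalDegree_sub _ _).trans (max_le ?_ ?_)) ?_)
      · simp
      · refine (totalDegree_mul _ _).trans ?_
        rw [totalDegree_C, totalDegree_X]
      · rw [totalDegree_C]; exact Nat.zero_le _
    · simp
    · simp only [map_sub, map_mul, rho_X2, rho_X0, rho_C, h1.1, h1.2]
      have : Polynomial.C (τ.1 ^ 2) * Polynomial.X + Polynomial.C (τ.1 * τ.2.1 + τ.2.2)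
        - Polynomial.C (τ.1 ^ 2) * Polynomial.X - Polynomial.C (τ.1 * τ.2.1 + σ.2.2) =
        Polynomial.C (τ.2.2 - σ.2.2) := by
        simp only [map_add, map_sub]; ring
      rw [this, Ne, Polynomial.C_eq_zero, sub_eq_zero]
      intro h2
      exact h (Prod.ext h1.1 (Prod.ext h1.2 h2.symm))
  · refine ⟨X 1 - C σ.1 * X 0 - C σ.2.1, ?_, ?_, ?_⟩
    · refine (totalDegree_sub _ _).trans (max_le ((totalDegree_sub _ _).trans (max_le ?_ ?_)) ?_)
      · simp
      · refine (totalDegree_mul _ _).trans ?_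
        rw [totalDegree_C, totalDegree_X]
      · rw [totalDegree_C]; exact Nat.zero_le _
    · simp
    · simp only [map_sub, map_mul, rho_X1, rho_X0, rho_C]
      intro h0
      have e1 := congrArg (fun q => Polynomial.coeff q 1) h0
      have e0 := congrArg (fun q => Polynomial.coeff q 0) h0
      simp at e1 e0
      rw [sub_eq_zero] at e1 e0
      exact h1 ⟨e1.symm, e0.symm⟩

lemma exists_sep {F : Type*} [Field F] (T : Finset (F × F × F)) (τ : F × F × F) (hτ : τ ∈ T) :
    ∃ A : MvPolynomial (Fin 3) F, A.totalDegree ≤ T.card - 1 ∧ (∀ σ ∈ T, σ ≠ τ → rho σ A = 0) ∧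
      rho τ A ≠ 0 := by
  choose! A h1 h2 h3 using fun σ (h : σ ≠ τ) => exists_plane σ τ h
  refine ⟨∏ σ ∈ T.erase τ, A σ, ?_, ?_, ?_⟩
  · refine (totalDegree_finsetProd _ _).trans ?_
    refine (Finset.sum_le_card_nsmul _ _ 1 ?_).trans ?_
    · intro σ hσ
      exact h1 σ (Finset.ne_of_mem_erase hσ)
    · simp [Finset.card_erase_of_mem hτ]
  · intro σ hσ hne
    rw [map_prod]
    exact Finset.prod_eq_zero (Finset.mem_erase.mpr ⟨hne, hσ⟩) (h2 σ hne)
  · rw [map_prod, Finset.prod_ne_zero_iff]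
    intro σ hσ
    exact h3 σ (Finset.ne_of_mem_erase hσ)

lemma totalDegree_aevalX0 {F : Type*} [Field F] (c : Polynomial F) :
    (Polynomial.aeval (X 0 : MvPolynomial (Fin 3) F) c).totalDegree ≤ c.natDegree := by
  rw [Polynomial.aeval_eq_sum_range]
  refine (totalDegree_finsetSum _ _).trans (Finset.sup_le fun i hi => ?_)
  refine (totalDegree_smul_le _ _).trans ?_
  rw [totalDegree_X_pow]
  exact Nat.lt_succ_iff.mp (Finset.mem_range.mp hi)

lemma finrank_map_mul {F : Type*} [Field F] (G : MvPolynomial (Fin 3) F) (hG : G ≠ 0)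
    (V : Submodule F (MvPolynomial (Fin 3) F)) :
    Module.finrank F (V.map (LinearMap.mulLeft F G)) = Module.finrank F V := by
  have hinj : Function.Injective (LinearMap.mulLeft F G) := fun a b h => mul_left_cancel₀ hG h
  exact (Submodule.equivMapOfInjective _ hinj V).finrank_eq.symm

lemma bezout_arith (d e m j q : ℕ) (hj2 : j + m = q + d + e + 1) (hqm : q = (d * e + 1) * m)
    (hm1 : d * e + 1 ≤ m) (hin7 : 2 * (m * j) ≤ d * e * (2 * q + d + e + 4)) : False := by
  have h8 : (d * e + 1) * j ≤ m * j := Nat.mul_le_mul_right _ hm1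
  zify at *
  have hjj : (j : ℤ) = q + d + e + 1 - m := by linarith
  have hde : (0 : ℤ) ≤ d * e := by positivity
  have h9 : 2 * ((d * e + 1) * (j : ℤ)) =
      2 * (d * e) * q + 2 * (d * e + 1) * (d + e + 1) := by
    rw [hjj, hqm]; ring
  have h10 : (d * e : ℤ) * (d + e - 2) + 2 * (d + e + 1) ≤ 0 := by
    have : (d * e : ℤ) * (2 * q + d + e + 4) = 2 * (d * e) * q + (d * e) * (d + e + 4) := by ring
    rw [this] at hin7
    have h11 : 2 * (d * e + 1) * (d + e + 1) ≤ (d * e : ℤ) * (d + e + 4) := by linarith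
    have : (d * e : ℤ) * (d + e - 2) + 2 * (d + e + 1) =
      2 * (d * e + 1) * (d + e + 1) - (d * e : ℤ) * (d + e + 4) := by ring
    linarith
  have hd0 : (0 : ℤ) ≤ d := by positivity
  have he0 : (0 : ℤ) ≤ e := by positivity
  rcases hd0.eq_or_lt with h0 | h0
  · rw [← h0] at h10; linarith
  rcases he0.eq_or_lt with h1 | h1
  · rw [← h1] at h10; linarith
  have : (0 : ℤ) ≤ (d * e : ℤ) * (d + e - 2) := mul_nonneg hde (by linarith)
  linarith

lemma bezout_rays {F : Type*} [Field F] (G R : MvPolynomial (Fin 3) F) (hG : Irreducible G)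
    (hR : ¬ G ∣ R) (T : Finset (F × F × F)) (hT : ∀ τ ∈ T, rho τ G = 0 ∧ rho τ R = 0) :
    T.card ≤ G.totalDegree * R.totalDegree := by
  set d := G.totalDegree with hd
  set e := R.totalDegree with he
  set m := T.card with hm
  by_contra hlt
  push Not at hlt
  have hG0 : G ≠ 0 := hG.ne_zero
  have hR0 : R ≠ 0 := by rintro rfl; exact hR (dvd_zero _)
  set k := (d * e + 1) * m + d + e with hk
  have hkm : m ≤ k := by nlinarith [Nat.zero_le (d * e * m)]
  set V : ℕ → Submodule F (MvPolynomial (Fin 3) F) := fun k => restrictTotalDegree (Fin 3) F k with hV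
  have hVf : ∀ k, FiniteDimensional F (V k) := fun k => by rw [hV]; infer_instance
  set A := (V (k - d)).map (LinearMap.mulLeft F G) with hA
  set B := (V (k - e)).map (LinearMap.mulLeft F R) with hB
  have hAV : A ≤ V k := by
    rw [hA, Submodule.map_le_iff_le_comap]
    intro f hf
    simp only [Submodule.mem_comap, LinearMap.mulLeft_apply, hV, mem_restrictTotalDegree] at hf ⊢
    refine (totalDegree_mul _ _).trans ?_
    omega
  have hBV : B ≤ V k := by
    rw [hB, Submodule.map_le_iff_le_comap]
    intro f hf
    simp only [Submodule.mem_comap, LinearMap.mulLeft_apply, hV, mem_restrictTotalDegree] at hf ⊢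
    refine (totalDegree_mul _ _).trans ?_
    omega
  have hinf : A ⊓ B ≤ (V (k - d - e)).map (LinearMap.mulLeft F (G * R)) := by
    rintro f ⟨⟨a, ha, rfl⟩, ⟨b, hb, hab⟩⟩
    simp only [LinearMap.mulLeft_apply] at hab ⊢
    have hdv : G ∣ b := by
      have : G ∣ R * b := ⟨a, hab⟩
      exact (hG.prime.dvd_or_dvd this).resolve_left hR
    obtain ⟨c, rfl⟩ := hdv
    refine ⟨c, ?_, ?_⟩
    · by_cases hc : c = 0
      · subst hc; exact Submodule.zero_mem _
      have h1 : totalDegree (G * c) ≤ k - e := (mem_restrictTotalDegree _ _ _).mp hb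
      rw [totalDegree_mul_of_isDomain hG0 hc] at h1
      refine (mem_restrictTotalDegree _ _ _).mpr ?_
      omega
    · simp only [LinearMap.mulLeft_apply]
      rw [← hab]; ring
  -- separators
  have hsep : ∀ τ : T, ∃ A : MvPolynomial (Fin 3) F, A.totalDegree ≤ m - 1 ∧
      (∀ σ ∈ T, σ ≠ τ.1 → rho σ A = 0) ∧ rho τ.1 A ≠ 0 := fun τ => exists_sep T τ.1 τ.2
  choose π hπ1 hπ2 hπ3 using hsep
  set j := k + 1 - m with hj
  let Θ : (T → Polynomial.degreeLT F j) →ₗ[F] MvPolynomial (Fin 3) F :=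
    ∑ τ : T, (LinearMap.mulRight F (π τ)) ∘ₗ (Polynomial.aeval (X 0 : MvPolynomial (Fin 3) F)).toLinearMap
      ∘ₗ (Polynomial.degreeLT F j).subtype ∘ₗ (LinearMap.proj τ)
  have hΘ : ∀ c, Θ c = ∑ τ : T, Polynomial.aeval (X 0 : MvPolynomial (Fin 3) F) (c τ).1 * π τ := by
    intro c; simp [Θ]
  have hΘρ : ∀ c (σ : T), rho σ.1 (Θ c) = (c σ).1 * rho σ.1 (π σ) := by
    intro c σ
    rw [hΘ, map_sum, Finset.sum_eq_single σ]
    · rw [map_mul]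
      congr 1
      rw [← Polynomial.aeval_algHom_apply, rho_X0]
      simp
    · intro τ _ hne
      rw [map_mul, hπ2 τ σ.1 σ.2 (fun h => hne (Subtype.ext h.symm)), mul_zero]
    · simp
  have hΘ0 : ∀ c, (∀ τ ∈ T, rho τ (Θ c) = 0) → c = 0 := by
    intro c h
    funext σ
    have := h σ.1 σ.2
    rw [hΘρ] at this
    rcases mul_eq_zero.mp this with h1 | h1
    · exact Subtype.ext h1
    · exact absurd h1 (hπ3 σ)
  have hΘinj : Function.Injective Θ := by
    rw [injective_iff_map_eq_zero]
    intro c hc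
    exact hΘ0 c fun τ _ => by rw [hc, map_zero]
  have hΘV : LinearMap.range Θ ≤ V k := by
    rintro _ ⟨c, rfl⟩
    rw [hΘ]
    refine Submodule.sum_mem _ fun τ _ => ?_
    refine (mem_restrictTotalDegree _ _ _).mpr ((totalDegree_mul _ _).trans ?_)
    have h1 := totalDegree_aevalX0 (c τ).1
    have h2 := hπ1 τ
    have h3 : 0 < m := by rw [hm]; exact Finset.card_pos.mpr ⟨τ.1, τ.2⟩
    have h4 : (c τ).1.natDegree ≤ j - 1 := by
      have := Polynomial.mem_degreeLT.mp (c τ).2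
      by_cases h0 : (c τ).1 = 0
      · simp [h0]
      · rw [Polynomial.degree_eq_natDegree h0] at this
        have : (c τ).1.natDegree < j := by exact_mod_cast this
        omega
    omega
  have hdis : Disjoint (LinearMap.range Θ) (A ⊔ B) := by
    rw [Submodule.disjoint_def]
    rintro _ ⟨c, rfl⟩ hc
    obtain ⟨_, ⟨a, -, rfl⟩, _, ⟨b, -, rfl⟩, hab⟩ := Submodule.mem_sup.mp hc
    have : c = 0 := by
      apply hΘ0
      intro τ hτ
      rw [← hab]
      simp [(hT τ hτ).1, (hT τ hτ).2]
    rw [this, map_zero]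
  have f1 : Module.finrank F (LinearMap.range Θ) = m * j := by
    rw [LinearMap.finrank_range_of_inj hΘinj, Module.finrank_pi_fintype]
    have : Module.finrank F (Polynomial.degreeLT F j) = j := by
      rw [(Polynomial.degreeLTEquiv F j).finrank_eq]; simp
    simp [this, hm]
  have : FiniteDimensional F A := by rw [hA]; infer_instance
  have : FiniteDimensional F B := by rw [hB]; infer_instance
  have : FiniteDimensional F (LinearMap.range Θ) := Submodule.finiteDimensional_of_le hΘV
  have f2 := Submodule.finrank_sup_add_finrank_inf_eq A B
  have f3 := Submodule.finrank_sup_add_finrank_inf_eq (LinearMap.range Θ) (A ⊔ B)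
  rw [hdis.eq_bot, finrank_bot, add_zero, f1] at f3
  have f4 : Module.finrank F (LinearMap.range Θ ⊔ (A ⊔ B) : Submodule F _) ≤ Module.finrank F (V k) :=
    Submodule.finrank_mono (sup_le hΘV (sup_le hAV hBV))
  have f5 := Submodule.finrank_mono hinf
  rw [finrank_map_mul _ (mul_ne_zero hG0 hR0)] at f5
  have f6 : Module.finrank F A = Module.finrank F (V (k - d)) := finrank_map_mul _ hG0 _
  have f7 : Module.finrank F B = Module.finrank F (V (k - e)) := finrank_map_mul _ hR0 _
  have g0 := finrank_vdeg F k
  have g1 := finrank_vdeg F (k - d)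
  have g2 := finrank_vdeg F (k - e)
  have g3 := finrank_vdeg F (k - d - e)
  change 6 * Module.finrank F (V k) = _ at g0
  change 6 * Module.finrank F (V (k - d)) = _ at g1
  change 6 * Module.finrank F (V (k - e)) = _ at g2
  change 6 * Module.finrank F (V (k - d - e)) = _ at g3
  have hk' : k = (k - d - e) + d + e := by omega
  have hin : m * j + Module.finrank F (V (k - d)) + Module.finrank F (V (k - e)) ≤
    Module.finrank F (V k) + Module.finrank F (V (k - d - e)) := by omega
  have hje : j + m = k + 1 := by omega
  generalize hq : k - d - e = q at *
  have hkd : k - d = q + e := by omega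
  have hke : k - e = q + d := by omega
  rw [hkd] at g1 hin
  rw [hke] at g2 hin
  have hm1 : d * e + 1 ≤ m := hlt
  have hqm : q = (d * e + 1) * m := by omega
  have hin6 : 6 * (m * j) + (q + e + 1) * (q + e + 2) * (q + e + 3) + (q + d + 1) * (q + d + 2) * (q + d + 3)
      ≤ (k + 1) * (k + 2) * (k + 3) + (q + 1) * (q + 2) * (q + 3) := by
    rw [← g0, ← g1, ← g2, ← g3]; omega
  rw [hk'] at hin6
  -- algebra : m * j ≤ d e (q + 2 + (d+e)/2)
  have hin7 : 2 * (m * j) ≤ d * e * (2 * q + d + e + 4) := by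
    have : (q + d + e + 1) * (q + d + e + 2) * (q + d + e + 3) + (q + 1) * (q + 2) * (q + 3) =
      (q + e + 1) * (q + e + 2) * (q + e + 3) + (q + d + 1) * (q + d + 2) * (q + d + 3)
      + 3 * (d * e * (2 * q + d + e + 4)) := by ring
    omega
  have hj2 : j + m = q + d + e + 1 := by omega
  exact bezout_arith d e m j q hj2 hqm hm1 hin7
end PolyDim


section RayCalc
open MvPolynomial

lemma pderiv_comm' {F : Type*} [Field F] (i j : Fin 3) (G : MvPolynomial (Fin 3) F) :
    pderiv i (pderiv j G) = pderiv j (pderiv i G) := by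
  ext m
  simp only [coeff_pderiv]
  by_cases h : i = j
  · subst h; rfl
  · have h' : j ≠ i := fun h0 => h h0.symm
    simp [h, h']
    rw [add_right_comm]; ring

lemma totalDegree_pderiv_le {F : Type*} [Field F] (i : Fin 3) (G : MvPolynomial (Fin 3) F) :
    (pderiv i G).totalDegree ≤ G.totalDegree - 1 := by
  refine Finset.sup_le fun m hm => ?_
  rw [mem_support_iff, coeff_pderiv] at hm
  have h1 : m + Finsupp.single i 1 ∈ G.support := mem_support_iff.mpr (left_ne_zero_of_mul hm)
  have h2 := le_totalDegree h1
  rw [Finsupp.sum_add_index' (by simp) (by simp), Finsupp.sum_single_index rfl] at h2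
  omega

lemma totalDegree_pos_of_irred {F : Type*} [Field F] {G : MvPolynomial (Fin 3) F}
    (hG : Irreducible G) : 0 < G.totalDegree := by
  by_contra h
  have h0 : G.totalDegree = 0 := by omega
  have h1 := totalDegree_eq_zero_iff_eq_C.mp h0
  rw [h1] at hG
  have : coeff 0 G ≠ 0 := fun h => by rw [h, C_0] at hG; exact hG.ne_zero rfl
  exact hG.not_isUnit ((Ne.isUnit this).map C)

lemma exists_pderiv_ne {F : Type*} [Field F] {p : ℕ} [CharP F p] {G : MvPolynomial (Fin 3) F}
    (h0 : 0 < G.totalDegree) (hp : G.totalDegree < p) : ∃ i, pderiv i G ≠ 0 := by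
  have hG0 : G ≠ 0 := by rintro rfl; simp at h0
  have hne : G.support.Nonempty := by
    rw [Finset.nonempty_iff_ne_empty]; simpa using hG0
  obtain ⟨m, hm, hs⟩ := Finset.exists_mem_eq_sup G.support hne (fun s => s.sum fun _ e => e)
  have hs' : G.totalDegree = m.sum fun _ e => e := hs
  have : ∃ i, m i ≠ 0 := by
    by_contra hcon
    push Not at hcon
    have : m = 0 := Finsupp.ext hcon
    rw [this] at hs'
    simp at hs'
    omega
  obtain ⟨i, hi⟩ := this
  refine ⟨i, fun h => ?_⟩
  have h1 := congrArg (coeff (m - Finsupp.single i 1)) h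
  have hmm : m - Finsupp.single i 1 + Finsupp.single i 1 = m := by
    apply tsub_add_cancel_of_le
    simpa using Nat.one_le_iff_ne_zero.mpr hi
  rw [coeff_pderiv, hmm, coeff_zero] at h1
  rcases mul_eq_zero.mp h1 with h2 | h2
  · exact mem_support_iff.mp hm h2
  · have h3 : ((m i : ℕ) : F) = 0 := by
      have := congrArg (fun f : Fin 3 →₀ ℕ => ((f i : ℕ) : F)) hmm
      simp only [Finsupp.add_apply, Finsupp.single_eq_same, Nat.cast_add, Nat.cast_one] at this
      rw [← this]; exact_mod_cast h2
    rw [CharP.cast_eq_zero_iff F p] at h3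
    have h4 := Nat.le_of_dvd (Nat.pos_of_ne_zero hi) h3
    have h5 : m i ≤ m.sum fun _ e => e := by
      rw [Finsupp.sum_fintype _ _ (by simp)]
      exact Finset.single_le_sum (f := fun i => m i) (by simp) (Finset.mem_univ i)
    omega

/-- directional derivative along rays of slope `t` -/
noncomputable def Dt {F : Type*} [Field F] (t : F) (G : MvPolynomial (Fin 3) F) :
    MvPolynomial (Fin 3) F := pderiv 0 G + C t * pderiv 1 G + C (t ^ 2) * pderiv 2 G

noncomputable def Et {F : Type*} [Field F] (t : F) (G : MvPolynomial (Fin 3) F) :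
    MvPolynomial (Fin 3) F := pderiv 1 G + C (2 * t) * pderiv 2 G

lemma deriv_rho {F : Type*} [Field F] (τ : F × F × F) (G : MvPolynomial (Fin 3) F) :
    Polynomial.derivative (rho τ G) = rho τ (Dt τ.1 G) := by
  unfold Dt
  induction G using MvPolynomial.induction_on with
  | C a => simp
  | add P Q hP hQ =>
    simp only [map_add, hP, hQ, map_mul]; ring
  | mul_X P i hP =>
    rw [map_mul, Polynomial.derivative_mul, hP]
    fin_cases i
    · simp [pderiv_X]; ring
    · simp [pderiv_X]; ring
    · simp [pderiv_X, Polynomial.derivative_pow]; ring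

/-- points on rays -/
def rpt {F : Type*} [Field F] (τ : F × F × F) (s : F) : Fin 3 → F :=
  ![s, τ.1 * s + τ.2.1, τ.1 ^ 2 * s + (τ.1 * τ.2.1 + τ.2.2)]

lemma eval_rho {F : Type*} [Field F] (τ : F × F × F) (s : F) (G : MvPolynomial (Fin 3) F) :
    (rho τ G).eval s = eval (rpt τ s) G := by
  induction G using MvPolynomial.induction_on with
  | C a => simp
  | add P Q hP hQ => simp [hP, hQ]
  | mul_X P i hP =>
    rw [map_mul, Polynomial.eval_mul, hP]
    fin_cases i <;> simp [rpt]

lemma rpt_meet {F : Type*} [Field F] (τ τ' : F × F × F) (h : τ.1 ≠ τ'.1) (s : F) :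
    rpt τ s = rpt τ' s ↔ s * (τ.1 - τ'.1) = τ'.2.1 - τ.2.1 ∧
      τ'.2.2 - τ.2.2 = τ.1 * τ'.2.1 - τ'.1 * τ.2.1 := by
  have h' : τ.1 - τ'.1 ≠ 0 := sub_ne_zero.mpr h
  constructor
  · intro e
    have e1 := congrFun e 1
    have e2 := congrFun e 2
    simp [rpt] at e1 e2
    refine ⟨by linear_combination e1, ?_⟩
    linear_combination (τ.1 + τ'.1) * e1 - e2
  · rintro ⟨e1, e2⟩
    ext i
    fin_cases i
    · simp [rpt]
    · simp [rpt]; linear_combination e1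
    · simp [rpt]; linear_combination (τ.1 + τ'.1) * e1 - e2

section defs
variable {F : Type*} [Field F] (G : MvPolynomial (Fin 3) F)

noncomputable def q0 := pderiv 0 (pderiv 0 G)
noncomputable def q1 := 2 * pderiv 0 (pderiv 1 G)
noncomputable def q2 := pderiv 1 (pderiv 1 G) + 2 * pderiv 0 (pderiv 2 G)
noncomputable def q3 := 2 * pderiv 1 (pderiv 2 G)
noncomputable def q4 := pderiv 2 (pderiv 2 G)
noncomputable def cA2 := (pderiv 2 G) ^ 2 * q4 G
noncomputable def cA1 := pderiv 2 G * (pderiv 2 G * q3 G - pderiv 1 G * q4 G)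
noncomputable def cA0 := (pderiv 2 G) ^ 2 * q2 G - pderiv 2 G * pderiv 0 G * q4 G
  - pderiv 1 G * (pderiv 2 G * q3 G - pderiv 1 G * q4 G)
noncomputable def cR1 := (pderiv 2 G) ^ 3 * q1 G - (pderiv 0 G * cA1 G + pderiv 1 G * cA0 G)
noncomputable def cR0 := (pderiv 2 G) ^ 3 * q0 G - pderiv 0 G * cA0 G

lemma DtDt (t : F) : Dt t (Dt t G) = q0 G + C t * q1 G + C t ^ 2 * q2 G + C t ^ 3 * q3 G
    + C t ^ 4 * q4 G := by
  simp only [Dt, q0, q1, q2, q3, q4, map_add, pderiv_C_mul, map_pow]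
  rw [pderiv_comm' 1 0, pderiv_comm' 2 0, pderiv_comm' 2 1]
  simp only [← map_pow, pderiv_C_mul]
  simp only [map_pow]
  ring

lemma DtEt (t : F) : 2 * Dt t (Et t G) = q1 G + 2 * C t * q2 G + 3 * C t ^ 2 * q3 G
    + 4 * C t ^ 3 * q4 G := by
  simp only [Dt, Et, q1, q2, q3, q4, map_add, pderiv_C_mul, map_pow]
  rw [pderiv_comm' 2 1]
  simp only [map_mul, show (C (2 : F) : MvPolynomial (Fin 3) F) = 2 from rfl]
  ring

lemma Erel (t : F) : (pderiv 2 G) ^ 3 * Dt t (Dt t G) =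
    Dt t G * (cA0 G + C t * cA1 G + C t ^ 2 * cA2 G) + (cR0 G + C t * cR1 G) := by
  rw [DtDt]
  simp only [Dt, cR0, cR1, cA0, cA1, cA2, map_pow]
  ring

lemma Erel' (t : F) : (pderiv 2 G) ^ 3 * (2 * Dt t (Et t G)) =
    Et t G * (cA0 G + C t * cA1 G + C t ^ 2 * cA2 G) + Dt t G * (cA1 G + 2 * C t * cA2 G)
     + cR1 G := by
  rw [DtEt]
  simp only [Dt, Et, cR0, cR1, cA0, cA1, cA2, map_pow, map_mul,
    show (C (2 : F) : MvPolynomial (Fin 3) F) = 2 from rfl]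
  ring

lemma Dt_pderiv (t : F) (i : Fin 3) : pderiv i (Dt t G) = Dt t (pderiv i G) := by
  simp only [Dt, map_add, pderiv_C_mul]
  rw [pderiv_comm' i 0, pderiv_comm' i 1, pderiv_comm' i 2]

lemma Dt_Et (t : F) : Dt t (Et t G) = Dt t (pderiv 1 G) + C (2 * t) * Dt t (pderiv 2 G) := by
  simp only [Dt, Et, map_add, pderiv_C_mul]
  ring

lemma rho_Dt {τ : F × F × F} (h : rho τ G = 0) : rho τ (Dt τ.1 G) = 0 := by
  rw [← deriv_rho, h, map_zero]

lemma totalDegree_cR : (cR0 G).totalDegree ≤ 4 * G.totalDegree ∧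
    (cR1 G).totalDegree ≤ 4 * G.totalDegree := by
  set d := G.totalDegree with hd
  have h1 : ∀ i, (pderiv i G).totalDegree ≤ d := fun i =>
    (totalDegree_pderiv_le i G).trans (Nat.sub_le _ _)
  have h2 : ∀ i j, (pderiv i (pderiv j G)).totalDegree ≤ d := fun i j =>
    ((totalDegree_pderiv_le i _).trans (Nat.sub_le _ _)).trans (h1 j)
  have hm : ∀ (A B : MvPolynomial (Fin 3) F) (a b c : ℕ), A.totalDegree ≤ a → B.totalDegree ≤ b →
    a + b = c → (A * B).totalDegree ≤ c := fun A B a b c ha hb hc =>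
    (totalDegree_mul _ _).trans (by omega)
  have ha : ∀ (A B : MvPolynomial (Fin 3) F) (a : ℕ), A.totalDegree ≤ a → B.totalDegree ≤ a →
    (A + B).totalDegree ≤ a := fun A B a ha hb => (totalDegree_add _ _).trans (max_le ha hb)
  have hs : ∀ (A B : MvPolynomial (Fin 3) F) (a : ℕ), A.totalDegree ≤ a → B.totalDegree ≤ a →
    (A - B).totalDegree ≤ a := fun A B a ha hb => (totalDegree_sub _ _).trans (max_le ha hb)
  have hp : ∀ (A : MvPolynomial (Fin 3) F) (n a c : ℕ), A.totalDegree ≤ a → n * a = c →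
    (A ^ n).totalDegree ≤ c := fun A n a c h hc =>
    (totalDegree_pow _ _).trans (by rw [← hc]; exact Nat.mul_le_mul_left _ h)
  have h22 : (2 : MvPolynomial (Fin 3) F).totalDegree ≤ 0 := by
    rw [show (2 : MvPolynomial (Fin 3) F) = C 2 from rfl, totalDegree_C]
  have e0 : (q0 G).totalDegree ≤ d := h2 _ _
  have e1 : (q1 G).totalDegree ≤ d := hm _ _ _ _ _ h22 (h2 _ _) (by omega)
  have e2 : (q2 G).totalDegree ≤ d := ha _ _ _ (h2 _ _) (hm _ _ _ _ _ h22 (h2 _ _) (by omega))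
  have e3 : (q3 G).totalDegree ≤ d := hm _ _ _ _ _ h22 (h2 _ _) (by omega)
  have e4 : (q4 G).totalDegree ≤ d := h2 _ _
  have e5 : (pderiv 2 G * q3 G - pderiv 1 G * q4 G).totalDegree ≤ 2 * d :=
    hs _ _ _ (hm _ _ _ _ _ (h1 _) e3 (by omega)) (hm _ _ _ _ _ (h1 _) e4 (by omega))
  have e6 : (cA1 G).totalDegree ≤ 3 * d := hm _ _ _ _ _ (h1 _) e5 (by omega)
  have e7 : (cA0 G).totalDegree ≤ 3 * d := by
    refine hs _ _ _ (hs _ _ _ (hm _ _ _ _ _ (hp _ _ _ _ (h1 _) rfl) e2 (by omega)) ?_) ?_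
    · exact hm _ _ _ _ _ (hm _ _ _ _ _ (h1 _) (h1 _) rfl) e4 (by omega)
    · exact hm _ _ _ _ _ (h1 _) e5 (by omega)
  constructor
  · exact hs _ _ _ (hm _ _ _ _ _ (hp _ _ _ _ (h1 _) rfl) e0 (by omega))
      (hm _ _ _ _ _ (h1 _) e7 (by omega))
  · exact hs _ _ _ (hm _ _ _ _ _ (hp _ _ _ _ (h1 _) rfl) e1 (by omega))
      (ha _ _ _ (hm _ _ _ _ _ (h1 _) e6 (by omega)) (hm _ _ _ _ _ (h1 _) e7 (by omega)))

lemma cR_vanish {τ τ' : F × F × F} (h : τ.1 ≠ τ'.1) {s : F} (hs : rpt τ s = rpt τ' s)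
    (h1 : rho τ G = 0) (h2 : rho τ' G = 0) :
    (rho τ (cR0 G)).eval s = 0 ∧ (rho τ (cR1 G)).eval s = 0 := by
  have key : ∀ σ : F × F × F, rho σ G = 0 → eval (rpt σ s) (cR0 G) + σ.1 * eval (rpt σ s) (cR1 G) = 0 := by
    intro σ hσ
    have e := congrArg (fun P => Polynomial.eval s (rho σ P)) (Erel G σ.1)
    have e1 := rho_Dt G hσ
    have e2 : rho σ (Dt σ.1 (Dt σ.1 G)) = 0 := rho_Dt _ e1
    simp only [map_mul, map_add, e1, e2, mul_zero, zero_mul, zero_add, rho_C, Polynomial.eval_add,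
      Polynomial.eval_mul, Polynomial.eval_C, Polynomial.eval_zero, eval_rho] at e
    exact e.symm
  have k1 := key τ h1
  have k2 := key τ' h2
  rw [← hs] at k2
  rw [eval_rho, eval_rho]
  have h3 : (τ.1 - τ'.1) * eval (rpt τ s) (cR1 G) = 0 := by linear_combination k1 - k2
  have h4 := (mul_eq_zero.mp h3).resolve_left (sub_ne_zero.mpr h)
  rw [h4] at k1
  exact ⟨by simpa using k1, h4⟩

lemma ode_rel {τ : F × F × F} (h1 : rho τ G = 0) (hg : rho τ (pderiv 2 G) ≠ 0)
    (hR0 : G ∣ cR0 G) (hR1 : G ∣ cR1 G) (f g : Polynomial F) (hf : f = rho τ (Et τ.1 G))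
    (hg' : g = rho τ (pderiv 2 G)) :
    f * (g * (Polynomial.derivative (Polynomial.derivative f)) - f * Polynomial.derivative (Polynomial.derivative g))
     = 2 * Polynomial.derivative f * (g * Polynomial.derivative f - f * Polynomial.derivative g) := by
  obtain ⟨B0, hB0⟩ := hR0
  obtain ⟨B1, hB1⟩ := hR1
  have E := Erel G τ.1
  have E' := Erel' G τ.1
  generalize cA0 G + C τ.1 * cA1 G + C τ.1 ^ 2 * cA2 G = A at E E'
  generalize cA1 G + 2 * C τ.1 * cA2 G = A' at E'
  rw [hB1] at E E'
  rw [hB0] at E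
  have e1 := rho_Dt G h1
  have e2 : rho τ (Dt τ.1 (Dt τ.1 G)) = 0 := rho_Dt _ e1
  have k0 := congrArg (rho τ) E'
  simp only [map_mul, map_add, h1, e1, zero_mul, add_zero, ← deriv_rho, ← hf, ← hg',
    map_pow, show rho τ (2 : MvPolynomial (Fin 3) F) = 2 from map_ofNat _ 2] at k0
  have kk : ∀ i, rho τ (pderiv 2 G) ^ 3 * Polynomial.derivative (Polynomial.derivative (rho τ (pderiv i G))) =
      Polynomial.derivative (rho τ (pderiv i G)) * rho τ A + rho τ (pderiv i G) * rho τ (B0 + C τ.1 * B1) := by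
    intro i
    have k := congrArg (fun P => rho τ (pderiv i P)) E
    simp only [map_add, pderiv_mul, pderiv_pow, pderiv_C_mul, map_mul, h1, e1, e2, mul_zero, zero_mul,
      add_zero, zero_add, Dt_pderiv, map_pow] at k
    rw [deriv_rho, deriv_rho, map_add, map_mul]
    rw [k]; ring
  have k1 := kk 1
  have k2 := kk 2
  have hf1 : rho τ (pderiv 1 G) = f - Polynomial.C (2 * τ.1) * g := by
    rw [hf, hg', Et, map_add, map_mul, rho_C]; ring
  rw [hf1, ← hg'] at k1
  rw [← hg'] at k2 hg
  simp only [Polynomial.derivative_sub, Polynomial.derivative_C_mul] at k1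
  apply mul_left_cancel₀ (pow_ne_zero 3 hg)
  linear_combination f * g * k1 + f * (Polynomial.C (2 * τ.1) * g - f) * k2 - (g * Polynomial.derivative f - f * Polynomial.derivative g) * k0

end defs
end RayCalc


section Wron
open Polynomial

lemma natDegree_zero_of_deriv {F : Type*} [Field F] {p : ℕ} [CharP F p] {u : Polynomial F}
    (hu : u.natDegree < p) (h : derivative u = 0) : u.natDegree = 0 := by
  by_contra hne
  have h1 := congrArg (fun q => coeff q (u.natDegree - 1)) h
  simp only [coeff_derivative, coeff_zero] at h1
  have e : u.natDegree - 1 + 1 = u.natDegree := by omega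
  rw [e] at h1
  rcases mul_eq_zero.mp h1 with h2 | h2
  · rw [coeff_natDegree, leadingCoeff_eq_zero] at h2
    rw [h2] at hne; simp at hne
  · have h3 : ((u.natDegree : ℕ) : F) = 0 := by
      rw [← e]; push_cast; exact h2
    rw [CharP.cast_eq_zero_iff F p] at h3
    have := Nat.le_of_dvd (by omega) h3
    omega

lemma wronskian_const {F : Type*} [Field F] {p : ℕ} [CharP F p] {u w : Polynomial F}
    (hu : u.natDegree < p) (hw : w.natDegree < p) (hw0 : w ≠ 0)
    (h : derivative u * w = u * derivative w) : ∃ c : F, u = C c * w := by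
  by_cases hu0 : u = 0
  · exact ⟨0, by simp [hu0]⟩
  set g := EuclideanDomain.gcd u w with hg
  have hg0 : g ≠ 0 := fun h0 => hw0 (EuclideanDomain.gcd_eq_zero_iff.mp h0).2
  obtain ⟨u1, hu1⟩ := EuclideanDomain.gcd_dvd_left u w
  obtain ⟨w1, hw1⟩ := EuclideanDomain.gcd_dvd_right u w
  rw [← hg] at hu1 hw1
  have hco : IsCoprime u1 w1 := by
    have := EuclideanDomain.gcd_eq_gcd_ab u w
    rw [← hg] at this
    refine ⟨EuclideanDomain.gcdA u w, EuclideanDomain.gcdB u w, ?_⟩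
    apply mul_left_cancel₀ hg0
    linear_combination - this - EuclideanDomain.gcdA u w * hu1 - EuclideanDomain.gcdB u w * hw1
  have hwr : wronskian u1 w1 = 0 := by
    rw [wronskian]
    apply mul_left_cancel₀ (pow_ne_zero 2 hg0)
    have e1 := congrArg derivative hu1
    have e2 := congrArg derivative hw1
    rw [e1, e2] at h
    simp only [derivative_mul] at h
    rw [hu1, hw1] at h
    clear_value g
    linear_combination - h
  obtain ⟨d1, d2⟩ := hco.wronskian_eq_zero_iff.mp hwr
  have hu10 : u1 ≠ 0 := by rintro rfl; simp at hu1; exact hu0 hu1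
  have hw10 : w1 ≠ 0 := by rintro rfl; simp at hw1; exact hw0 hw1
  have n1 : u1.natDegree ≤ u.natDegree := by rw [hu1, natDegree_mul hg0 hu10]; omega
  have n2 : w1.natDegree ≤ w.natDegree := by rw [hw1, natDegree_mul hg0 hw10]; omega
  have z1 := natDegree_zero_of_deriv (p := p) (by omega) d1
  have z2 := natDegree_zero_of_deriv (p := p) (by omega) d2
  obtain ⟨a, ha⟩ := natDegree_eq_zero.mp z1
  obtain ⟨b, hb⟩ := natDegree_eq_zero.mp z2
  have hb0 : b ≠ 0 := by rintro rfl; simp at hb; exact hw10 hb.symm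
  refine ⟨a / b, ?_⟩
  rw [hu1, hw1, ← ha, ← hb, mul_left_comm, ← C_mul, div_mul_cancel₀ _ hb0]

lemma ode_solve {F : Type*} [Field F] {p : ℕ} [CharP F p] {f g : Polynomial F} {d : ℕ}
    (hd : 2 * d + 2 < p) (hf : f.natDegree ≤ d) (hg : g.natDegree ≤ d) (hf0 : f ≠ 0)
    (h : f * (g * (derivative (derivative f)) - f * derivative (derivative g))
     = 2 * derivative f * (g * derivative f - f * derivative g)) :
    ∃ α β : F, g = (C α * X + C β) * f := by
  have hf' : (derivative f).natDegree ≤ d := (natDegree_derivative_le f).trans (by omega)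
  have hg' : (derivative g).natDegree ≤ d := (natDegree_derivative_le g).trans (by omega)
  have hW : (g * derivative f - f * derivative g).natDegree ≤ 2 * d := by
    refine (natDegree_sub_le _ _).trans (max_le ?_ ?_)
    · exact (natDegree_mul_le).trans (by omega)
    · exact (natDegree_mul_le).trans (by omega)
  have hff : (f ^ 2).natDegree ≤ 2 * d := (natDegree_pow_le).trans (by omega)
  obtain ⟨c, hc⟩ := wronskian_const (p := p) (u := g * derivative f - f * derivative g) (w := f ^ 2)
    (by omega) (by omega) (pow_ne_zero 2 hf0) (by
      simp only [derivative_sub, derivative_mul, derivative_pow]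
      simp [show (C (2 : F)) = 2 from rfl]
      linear_combination f * h)
  obtain ⟨β, hβ⟩ := wronskian_const (p := p) (u := g + C c * X * f) (w := f) (by
      have : (g + C c * X * f).natDegree ≤ d + 1 := by
        refine (natDegree_add_le _ _).trans (max_le (by omega) ?_)
        refine (natDegree_mul_le).trans ?_
        have : (C c * X).natDegree ≤ 1 := natDegree_C_mul_le _ _ |>.trans natDegree_X_le
        omega
      omega) (by omega) hf0 (by
      simp only [derivative_add, derivative_mul, derivative_C, derivative_X]
      linear_combination - hc)
  refine ⟨-c, β, ?_⟩
  simp only [C_neg]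
  linear_combination hβ

end Wron

section RayStruct
open MvPolynomial

lemma Et_cross {F : Type*} [Field F] (G : MvPolynomial (Fin 3) F)
    {τ τ' : F × F × F} (h : τ.1 ≠ τ'.1) {s : F} (hs : rpt τ s = rpt τ' s)
    (h1 : rho τ G = 0) (h2 : rho τ' G = 0) :
    (rho τ (Et τ.1 G)).eval s = (rho τ (pderiv 2 G)).eval s * (τ.1 - τ'.1) := by
  have k1 := congrArg (Polynomial.eval s) (rho_Dt G h1)
  have k2 := congrArg (Polynomial.eval s) (rho_Dt G h2)
  rw [eval_rho] at k1 k2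
  rw [← hs] at k2
  rw [eval_rho, eval_rho]
  simp only [Dt, Et, map_add, map_mul, eval_C, Polynomial.eval_zero] at k1 k2 ⊢
  apply mul_left_cancel₀ (sub_ne_zero.mpr h)
  linear_combination k1 - k2

lemma poly_zero_of_roots {F : Type*} [Field F] {u : Polynomial F} {d : ℕ} (hu : u.natDegree ≤ d)
    (S : Finset F) (hS : d < S.card) (h : ∀ s ∈ S, u.eval s = 0) : u = 0 :=
  Polynomial.eq_zero_of_natDegree_lt_card_of_eval_eq_zero' u S h (by omega)

lemma ray_structure {F : Type*} [Field F] {p : ℕ} [CharP F p] (G : MvPolynomial (Fin 3) F)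
    (hp : 2 * G.totalDegree + 2 < p) (hR0 : G ∣ cR0 G) (hR1 : G ∣ cR1 G) {τ : F × F × F}
    (h1 : rho τ G = 0) (hns : ∃ i, rho τ (pderiv i G) ≠ 0)
    (S : Finset F) (hS : G.totalDegree < S.card)
    (hcr : ∀ s ∈ S, ∃ τ' : F × F × F, τ.1 ≠ τ'.1 ∧ rho τ' G = 0 ∧ rpt τ s = rpt τ' s) :
    ∃ (f : Polynomial F) (α β : F), f ≠ 0 ∧ f.natDegree ≤ G.totalDegree ∧
      ∀ (τ' : F × F × F) (s : F), τ.1 ≠ τ'.1 → rho τ' G = 0 → rpt τ s = rpt τ' s → f.eval s ≠ 0 →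
        α * (τ'.2.1 - τ.2.1) + β * (τ.1 - τ'.1) = 1 := by
  set d := G.totalDegree with hd
  set g := rho τ (pderiv 2 G) with hg
  set f := rho τ (Et τ.1 G) with hf
  have pd : ∀ i, (pderiv i G).totalDegree ≤ d := fun i =>
    (totalDegree_pderiv_le i G).trans (Nat.sub_le _ _)
  have hgd : g.natDegree ≤ d := (rho_natDegree _ _).trans (pd 2)
  have hfd : f.natDegree ≤ d := by
    refine (rho_natDegree _ _).trans ((totalDegree_add _ _).trans (max_le (pd 1) ?_))
    refine (totalDegree_mul _ _).trans ?_
    rw [totalDegree_C]; have := pd 2; omega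
  have hg0 : g ≠ 0 := by
    intro hg0
    have hf0 : f = 0 := by
      apply poly_zero_of_roots hfd S hS
      intro s hs
      obtain ⟨τ', h3, h4, h5⟩ := hcr s hs
      rw [hf, Et_cross G h3 h5 h1 h4, ← hg, hg0]; simp
    have e1 : rho τ (pderiv 1 G) = 0 := by
      rw [Et, map_add, map_mul, ← hg, hg0, mul_zero, add_zero] at hf
      rw [← hf, hf0]
    have e0 : rho τ (pderiv 0 G) = 0 := by
      have := rho_Dt G h1
      rw [Dt, map_add, map_add, map_mul, map_mul, e1, ← hg, hg0] at this
      simpa using this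
    obtain ⟨i, hi⟩ := hns
    apply hi
    fin_cases i
    · exact e0
    · exact e1
    · exact hg0
  have hf0 : f ≠ 0 := by
    intro hf0
    apply hg0
    apply poly_zero_of_roots hgd S hS
    intro s hs
    obtain ⟨τ', h3, h4, h5⟩ := hcr s hs
    have := Et_cross G h3 h5 h1 h4
    rw [← hf, ← hg, hf0, Polynomial.eval_zero] at this
    exact (mul_eq_zero.mp this.symm).resolve_right (sub_ne_zero.mpr h3)
  have ode := ode_rel G h1 hg0 hR0 hR1 f g hf hg
  obtain ⟨α, β, hab⟩ := ode_solve (p := p) hp hfd hgd hf0 ode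
  refine ⟨f, α, β, hf0, hfd, ?_⟩
  intro τ' s h3 h4 h5 h6
  have k := Et_cross G h3 h5 h1 h4
  rw [← hf, ← hg, hab] at k
  simp at k
  have k2 : (α * s + β) * (τ.1 - τ'.1) = 1 := by
    apply mul_left_cancel₀ h6
    linear_combination -k
  have k3 := ((rpt_meet _ _ h3 s).mp h5).1
  linear_combination k2 - α * k3

lemma singular_bound {F : Type*} [Field F] {p : ℕ} [CharP F p] (G : MvPolynomial (Fin 3) F)
    (hG : Irreducible G) (hp : G.totalDegree < p) (T : Finset (F × F × F))
    (hT : ∀ τ ∈ T, rho τ G = 0 ∧ ∀ i, rho τ (pderiv i G) = 0) :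
    T.card ≤ G.totalDegree * G.totalDegree := by
  have hpos := totalDegree_pos_of_irred hG
  obtain ⟨i, hi⟩ := exists_pderiv_ne (p := p) hpos hp
  have hle := totalDegree_pderiv_le i G
  have hnd : ¬ G ∣ pderiv i G := by
    rintro ⟨c, hc⟩
    have hc0 : c ≠ 0 := by rintro rfl; rw [mul_zero] at hc; exact hi hc
    have := totalDegree_mul_of_isDomain hG.ne_zero hc0
    rw [← hc] at this
    omega
  refine (bezout_rays G _ hG hnd T fun τ hτ => ⟨(hT τ hτ).1, (hT τ hτ).2 i⟩).trans ?_
  exact Nat.mul_le_mul_left _ (by omega)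
end RayStruct


section Core
open MvPolynomial

/-- crossing parameter of two rays -/
noncomputable def cs {F : Type*} [Field F] (σ τ : F × F × F) : F := (τ.2.1 - σ.2.1) / (σ.1 - τ.1)

lemma cs_comm {F : Type*} [Field F] (σ τ : F × F × F) : cs σ τ = cs τ σ := by
  unfold cs
  rw [← neg_sub σ.2.1, ← neg_sub τ.1, neg_div_neg_eq]

lemma rpt_cs {F : Type*} [Field F] {σ τ : F × F × F} (h : σ.1 ≠ τ.1)
    (h2 : τ.2.2 - σ.2.2 = σ.1 * τ.2.1 - τ.1 * σ.2.1) : rpt σ (cs σ τ) = rpt τ (cs σ τ) := by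
  rw [rpt_meet _ _ h]
  refine ⟨?_, h2⟩
  rw [cs, div_mul_cancel₀ _ (sub_ne_zero.mpr h)]

lemma ray_roots {F : Type*} [Field F] (G : MvPolynomial (Fin 3) F) (σ : F × F × F)
    (hσ : rho σ G ≠ 0) (T : Finset (F × F × F)) (hT : ∀ τ ∈ T, rho τ G = 0 ∧ rpt σ (cs σ τ) = rpt τ (cs σ τ))
    (hinj : Set.InjOn (cs σ) T) : T.card ≤ G.totalDegree := by
  rw [← Finset.card_image_of_injOn hinj]
  by_contra hlt
  apply hσ
  apply poly_zero_of_roots (rho_natDegree σ G) (T.image (cs σ)) (by omega)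
  intro s hs
  obtain ⟨τ, hτ, rfl⟩ := Finset.mem_image.mp hs
  rw [eval_rho, (hT τ hτ).2, ← eval_rho, (hT τ hτ).1, Polynomial.eval_zero]

lemma factor_deg {F : Type*} [Field F] (G0 : MvPolynomial (Fin 3) F) (h0 : G0 ≠ 0) :
    ∃ 𝒢 : Finset (MvPolynomial (Fin 3) F), (∀ G ∈ 𝒢, Irreducible G) ∧
      ∑ G ∈ 𝒢, G.totalDegree ≤ G0.totalDegree ∧
      ∀ σ : F × F × F, rho σ G0 = 0 → ∃ G ∈ 𝒢, rho σ G = 0 := by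
  let s := UniqueFactorizationMonoid.factors G0
  have hs : Associated s.prod G0 := UniqueFactorizationMonoid.factors_prod h0
  have hirr : ∀ G ∈ s, Irreducible G := fun G hG => UniqueFactorizationMonoid.irreducible_of_factor G hG
  refine ⟨s.toFinset, fun G hG => hirr G (Multiset.mem_toFinset.mp hG), ?_, ?_⟩
  · have h1 : s.prod.totalDegree ≤ G0.totalDegree := by
      obtain ⟨u, hu⟩ := hs
      have hs0 : s.prod ≠ 0 := by
        intro h; rw [h, zero_mul] at hu; exact h0 hu.symm
      rw [← hu, totalDegree_mul_of_isDomain hs0 u.ne_zero]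
      omega
    have h2 : ∀ m : Multiset (MvPolynomial (Fin 3) F), (∀ G ∈ m, Irreducible G) →
        m.prod.totalDegree = (m.map totalDegree).sum := by
      intro m
      induction m using Multiset.induction_on with
      | empty => intro _; simp
      | cons a m ih =>
        intro h
        rw [Multiset.prod_cons, Multiset.map_cons, Multiset.sum_cons,
          totalDegree_mul_of_isDomain, ih fun G hG => h G (Multiset.mem_cons_of_mem hG)]
        · exact (h a (Multiset.mem_cons_self _ _)).ne_zero
        · refine Multiset.prod_ne_zero fun h' => ?_
          exact (h 0 (Multiset.mem_cons_of_mem h')).ne_zero rfl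
    refine le_trans ?_ h1
    rw [h2 s hirr]
    rw [Finset.sum_eq_multiset_sum]
    have : s.toFinset.val ≤ s := by
      rw [Multiset.toFinset_val]; exact Multiset.dedup_le _
    obtain ⟨u, hu⟩ := Multiset.le_iff_exists_add.mp (Multiset.map_le_map (f := totalDegree) this)
    rw [hu, Multiset.sum_add]
    exact Nat.le_add_right _ _
  · intro σ hσ
    have h1 : rho σ s.prod = 0 := by
      obtain ⟨u, hu⟩ := hs
      have h2 : rho σ (s.prod * u) = 0 := by rw [hu, hσ]
      rw [map_mul] at h2
      refine (mul_eq_zero.mp h2).resolve_right ?_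
      exact (u.isUnit.map (rho σ)).ne_zero
    rw [map_multiset_prod, Multiset.prod_eq_zero_iff, Multiset.mem_map] at h1
    obtain ⟨G, hG, hG'⟩ := h1
    exact ⟨G, Multiset.mem_toFinset.mpr hG, hG'⟩

lemma core2 {F : Type*} [Field F] (E : F × F × F → F × F × F → Prop) (U V : Finset (F × F × F))
    (hE : ∀ σ τ, E σ τ → rpt σ (cs σ τ) = rpt τ (cs σ τ))
    (hinj : ∀ τ ∈ V, Set.InjOn (cs τ) (U.filter (fun σ => E σ τ) : Finset _))
    (G0 : MvPolynomial (Fin 3) F) (h0 : G0 ≠ 0) (D : ℕ) (hD : 1 ≤ D) (hG0 : G0.totalDegree ≤ D)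
    (hU : ∀ σ ∈ U, rho σ G0 = 0) (hUne : U.Nonempty) (Δ : ℝ) (hΔ : 2 * D ≤ Δ)
    (hdU : ∀ σ ∈ U, Δ ≤ (V.filter (fun τ => E σ τ)).card)
    (hdV : ∀ τ ∈ V, Δ ≤ (U.filter (fun σ => E σ τ)).card)
    (K : ℝ) (hK : ∀ σ ∈ U, ((V.filter (fun τ => E σ τ)).card : ℝ) ≤ K) :
    ∃ G : MvPolynomial (Fin 3) F, Irreducible G ∧ G.totalDegree ≤ D ∧ ∃ Up ⊆ U,
      (∀ σ ∈ Up, rho σ G = 0 ∧ Δ / 8 ≤ (V.filter (fun τ => E σ τ ∧ rho τ G = 0)).card) ∧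
      (ec E U V : ℝ) * G.totalDegree ≤ 4 * D * K * Up.card := by
  obtain ⟨𝒢, hirr, hsum, hcov⟩ := factor_deg G0 h0
  choose! φ hφ1 hφ2 using hcov
  set UG : MvPolynomial (Fin 3) F → Finset (F × F × F) := fun G => U.filter (fun σ => φ σ = G) with hUG
  set gd : MvPolynomial (Fin 3) F → F × F × F → ℕ :=
    fun G σ => (V.filter (fun τ => E σ τ ∧ rho τ G = 0)).card with hgd
  have hmaps : ∀ σ ∈ U, φ σ ∈ 𝒢 := fun σ hσ => hφ1 σ (hU σ hσ)
  have hne : 𝒢.Nonempty := by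
    obtain ⟨σ, hσ⟩ := hUne; exact ⟨_, hmaps σ hσ⟩
  -- bad edges
  have hbad : ∑ σ ∈ U, (V.filter (fun τ => E σ τ ∧ rho τ (φ σ) ≠ 0)).card ≤ D * V.card := by
    have hcm : ∑ σ ∈ U, (V.filter (fun τ => E σ τ ∧ rho τ (φ σ) ≠ 0)).card =
        ∑ τ ∈ V, (U.filter (fun σ => E σ τ ∧ rho τ (φ σ) ≠ 0)).card := by
      have h := ec_comm (fun σ τ => E σ τ ∧ rho τ (φ σ) ≠ 0) U V
      unfold ec at h
      convert h
    rw [hcm]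
    rw [mul_comm, ← smul_eq_mul]
    refine Finset.sum_le_card_nsmul _ _ _ fun τ hτ => ?_
    rw [Finset.card_eq_sum_card_fiberwise (f := φ) (t := 𝒢) (by
      intro σ hσ
      simp only [Finset.coe_filter, Set.mem_ofPred_eq] at hσ
      exact hmaps σ hσ.1)]
    refine le_trans (Finset.sum_le_sum fun G hG => ?_) (hsum.trans hG0)
    by_cases hz : rho τ G = 0
    · rw [Finset.card_eq_zero.mpr]
      · exact Nat.zero_le _
      rw [Finset.filter_eq_empty_iff]
      intro σ hσ hφ
      rw [Finset.mem_filter] at hσ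
      rw [hφ] at hσ
      exact hσ.2.2 hz
    · refine ray_roots G τ hz _ ?_ ?_
      · intro σ hσ
        simp only [Finset.mem_filter] at hσ
        refine ⟨?_, ?_⟩
        · rw [← hσ.2]; exact hφ2 σ (hU σ hσ.1.1)
        · rw [cs_comm]; exact (hE σ τ hσ.1.2.1).symm
      · refine (hinj τ hτ).mono ?_
        intro σ hσ
        simp only [Finset.coe_filter, Set.mem_ofPred_eq, Finset.mem_filter] at hσ ⊢
        exact ⟨hσ.1.1, hσ.1.2.1⟩
  have hgood : ec E U V ≤ ∑ σ ∈ U, gd (φ σ) σ + D * V.card := by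
    refine le_trans ?_ (Nat.add_le_add_left hbad _)
    rw [← Finset.sum_add_distrib]
    refine Finset.sum_le_sum fun σ _ => ?_
    rw [← Finset.card_filter_add_card_filter_not (s := V.filter (fun v => E σ v)) (fun τ => rho τ (φ σ) = 0)]
    rw [Finset.filter_filter, Finset.filter_filter]
  have hdVs : Δ * V.card ≤ ec E U V := by
    rw [ec_comm]; push_cast
    rw [mul_comm, ← nsmul_eq_mul]
    exact Finset.card_nsmul_le_sum _ _ _ hdV
  have hdUs : Δ * U.card ≤ ec E U V := by
    rw [ec]; push_cast
    rw [mul_comm, ← nsmul_eq_mul]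
    exact Finset.card_nsmul_le_sum _ _ _ hdU
  have hfib : ∑ σ ∈ U, gd (φ σ) σ = ∑ G ∈ 𝒢, ∑ σ ∈ UG G, gd G σ := by
    rw [← Finset.sum_fiberwise_of_maps_to hmaps]
    refine Finset.sum_congr rfl fun G _ => Finset.sum_congr rfl fun σ hσ => ?_
    rw [(Finset.mem_filter.mp hσ).2]
  have hcardfib : ∑ G ∈ 𝒢, (UG G).card = U.card := (Finset.card_eq_sum_card_fiberwise hmaps).symm
  have hDpos : (0 : ℝ) < D := by exact_mod_cast hD
  obtain ⟨G, hG, hGle⟩ : ∃ G ∈ 𝒢, Δ / 4 * (UG G).card + ec E U V / (4 * D) * G.totalDegree ≤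
      ((∑ σ ∈ UG G, gd G σ : ℕ) : ℝ) := by
    apply Finset.exists_le_of_sum_le hne
    rw [Finset.sum_add_distrib, ← Finset.mul_sum, ← Finset.mul_sum, ← Nat.cast_sum, ← Nat.cast_sum,
      ← Nat.cast_sum, hcardfib, ← hfib]
    have e1 : (ec E U V : ℝ) ≤ (∑ σ ∈ U, gd (φ σ) σ : ℕ) + D * V.card := by exact_mod_cast hgood
    have e2 : ((∑ G ∈ 𝒢, G.totalDegree : ℕ) : ℝ) ≤ D := by exact_mod_cast hsum.trans hG0
    have e3 : (ec E U V : ℝ) / (4 * D) * ((∑ G ∈ 𝒢, G.totalDegree : ℕ) : ℝ) ≤ ec E U V / 4 := by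
      calc (ec E U V : ℝ) / (4 * D) * ((∑ G ∈ 𝒢, G.totalDegree : ℕ) : ℝ) ≤ ec E U V / (4 * D) * D := by
            gcongr
        _ = ec E U V / 4 := by field_simp
    have e4 : (2 * D : ℝ) * V.card ≤ Δ * V.card := by gcongr
    linarith
  refine ⟨G, hirr G hG, ?_, (UG G).filter (fun σ => Δ / 8 ≤ gd G σ), ?_, ?_, ?_⟩
  · exact (Finset.single_le_sum (f := fun G => totalDegree G) (fun _ _ => Nat.zero_le _) hG).trans (hsum.trans hG0)
  · exact (Finset.filter_subset _ _).trans (Finset.filter_subset _ _)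
  · intro σ hσ
    simp only [hUG, Finset.mem_filter] at hσ
    refine ⟨?_, hσ.2⟩
    rw [← hσ.1.2]; exact hφ2 σ (hU σ hσ.1.1)
  · set Up := (UG G).filter (fun σ => Δ / 8 ≤ gd G σ) with hUp
    have hΔ0 : 0 ≤ Δ := by linarith
    have e1 : ((∑ σ ∈ UG G, gd G σ : ℕ) : ℝ) ≤ Δ / 8 * (UG G).card + K * Up.card := by
      push_cast
      rw [← Finset.sum_filter_add_sum_filter_not (UG G) (fun σ => Δ / 8 ≤ gd G σ), ← hUp]
      have a1 : ∑ σ ∈ Up, (gd G σ : ℝ) ≤ K * Up.card := by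
        rw [mul_comm, ← nsmul_eq_mul]
        refine Finset.sum_le_card_nsmul _ _ _ fun σ hσ => ?_
        have hσU : σ ∈ U := by
          simp only [hUp, hUG, Finset.mem_filter] at hσ; exact hσ.1.1
        refine le_trans ?_ (hK σ hσU)
        refine Nat.cast_le.mpr (Finset.card_le_card ?_)
        intro τ hτ
        simp only [Finset.mem_filter] at hτ ⊢
        exact ⟨hτ.1, hτ.2.1⟩
      have a2 : ∑ σ ∈ (UG G).filter (fun σ => ¬ Δ / 8 ≤ gd G σ), (gd G σ : ℝ) ≤ Δ / 8 * (UG G).card := by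
        refine (Finset.sum_le_card_nsmul _ _ (Δ / 8) fun σ hσ => ?_).trans ?_
        · exact (not_le.mp (Finset.mem_filter.mp hσ).2).le
        · rw [nsmul_eq_mul, mul_comm]
          gcongr
          exact Finset.filter_subset _ _
      linarith
    have e2 : (ec E U V : ℝ) / (4 * D) * G.totalDegree ≤ K * Up.card := by
      have : 0 ≤ Δ * (UG G).card := by positivity
      linarith
    have : (ec E U V : ℝ) * G.totalDegree = 4 * D * (ec E U V / (4 * D) * G.totalDegree) := by
      field_simp
    rw [this]
    calc 4 * (D : ℝ) * (ec E U V / (4 * D) * G.totalDegree) ≤ 4 * D * (K * Up.card) := by gcongr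
      _ = _ := by ring
end Core


section Core3
open MvPolynomial

lemma core3 {F : Type*} [Field F] {p : ℕ} [CharP F p] (E : F × F × F → F × F × F → Prop)
    (U V : Finset (F × F × F))
    (hE : ∀ σ τ, E σ τ → σ.1 ≠ τ.1 ∧ τ.2.2 - σ.2.2 = σ.1 * τ.2.1 - τ.1 * σ.2.1)
    (hinj : ∀ σ ∈ U, Set.InjOn (cs σ) (V.filter (fun τ => E σ τ) : Finset _))
    (D : ℕ) (hDp : 2 * D + 2 < p) (Δ k : ℝ) (hΔ : 32 * D < Δ) (hΔk : k < Δ / 8 - D)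
    (hline : ∀ σ ∈ U, ∀ α β : F, ((V.filter (fun τ => E σ τ ∧
      α * (τ.2.1 - σ.2.1) + β * (σ.1 - τ.1) = 1)).card : ℝ) ≤ k)
    (G : MvPolynomial (Fin 3) F) (hG : Irreducible G) (hGD : G.totalDegree ≤ D)
    (Up : Finset (F × F × F)) (hUp : Up ⊆ U)
    (hUp2 : ∀ σ ∈ Up, rho σ G = 0 ∧ Δ / 8 ≤ (V.filter (fun τ => E σ τ ∧ rho τ G = 0)).card)
    (hcard : 4 * (G.totalDegree * G.totalDegree) < Up.card) : False := by
  have hDR : (G.totalDegree : ℝ) ≤ D := by exact_mod_cast hGD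
  have hinj' : ∀ σ ∈ Up, Set.InjOn (cs σ) (V.filter (fun τ => E σ τ ∧ rho τ G = 0) : Finset _) := by
    intro σ hσ
    refine (hinj σ (hUp hσ)).mono ?_
    intro τ hτ
    simp only [Finset.coe_filter, Set.mem_ofPred_eq] at hτ ⊢
    exact ⟨hτ.1, hτ.2.1⟩
  have hvan : ∀ R : MvPolynomial (Fin 3) F, R.totalDegree ≤ 4 * G.totalDegree →
      (∀ σ ∈ Up, ∀ τ, E σ τ → rho τ G = 0 → (rho σ R).eval (cs σ τ) = 0) → G ∣ R := by
    intro R hR hz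
    by_contra hnd
    have : Up.card ≤ G.totalDegree * R.totalDegree := by
      refine bezout_rays G R hG hnd Up fun σ hσ => ⟨(hUp2 σ hσ).1, ?_⟩
      refine poly_zero_of_roots ((rho_natDegree σ R).trans hR)
        ((V.filter (fun τ => E σ τ ∧ rho τ G = 0)).image (cs σ)) ?_ ?_
      · rw [Finset.card_image_of_injOn (hinj' σ hσ)]
        have h1 := (hUp2 σ hσ).2
        have : (4 * G.totalDegree : ℝ) < (V.filter (fun τ => E σ τ ∧ rho τ G = 0)).card := by linarith
        exact_mod_cast this
      · intro s hs
        obtain ⟨τ, hτ, rfl⟩ := Finset.mem_image.mp hs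
        rw [Finset.mem_filter] at hτ
        exact hz σ hσ τ hτ.2.1 hτ.2.2
    have h2 : G.totalDegree * R.totalDegree ≤ G.totalDegree * (4 * G.totalDegree) :=
      Nat.mul_le_mul_left _ hR
    nlinarith
  have hR0 : G ∣ cR0 G := hvan _ (totalDegree_cR G).1 fun σ hσ τ hτ hτG =>
    (cR_vanish G (hE σ τ hτ).1 (rpt_cs (hE σ τ hτ).1 (hE σ τ hτ).2) (hUp2 σ hσ).1 hτG).1
  have hR1 : G ∣ cR1 G := hvan _ (totalDegree_cR G).2 fun σ hσ τ hτ hτG =>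
    (cR_vanish G (hE σ τ hτ).1 (rpt_cs (hE σ τ hτ).1 (hE σ τ hτ).2) (hUp2 σ hσ).1 hτG).2
  have hns : ∃ σ ∈ Up, ∃ i, rho σ (pderiv i G) ≠ 0 := by
    by_contra hcon
    push Not at hcon
    have := singular_bound (p := p) G hG (by omega) Up fun τ hτ => ⟨(hUp2 τ hτ).1, hcon τ hτ⟩
    omega
  obtain ⟨σ, hσ, hi⟩ := hns
  have hσ2 := (hUp2 σ hσ).2
  set T := V.filter (fun τ => E σ τ ∧ rho τ G = 0) with hT
  have hTc : G.totalDegree < T.card := by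
    have : (G.totalDegree : ℝ) < T.card := by
      have : (0 : ℝ) ≤ D := by positivity
      linarith
    exact_mod_cast this
  have hTi : Set.InjOn (cs σ) T := hinj' σ hσ
  obtain ⟨f, α, β, hf0, hfd, hfl⟩ := ray_structure (p := p) G (by omega) hR0 hR1 (hUp2 σ hσ).1 hi
    (T.image (cs σ)) (by rwa [Finset.card_image_of_injOn hTi]) (by
      intro s hs
      obtain ⟨τ, hτ, rfl⟩ := Finset.mem_image.mp hs
      rw [hT, Finset.mem_filter] at hτ
      exact ⟨τ, (hE σ τ hτ.2.1).1, hτ.2.2, rpt_cs (hE σ τ hτ.2.1).1 (hE σ τ hτ.2.1).2⟩)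
  have hsplit := Finset.card_filter_add_card_filter_not (s := T) (fun τ => f.eval (cs σ τ) = 0)
  have hz : (T.filter (fun τ => f.eval (cs σ τ) = 0)).card ≤ D := by
    have hi2 : Set.InjOn (cs σ) (T.filter (fun τ => f.eval (cs σ τ) = 0) : Finset _) :=
      hTi.mono (by intro τ hτ; simp only [Finset.coe_filter, Set.mem_ofPred_eq] at hτ; exact hτ.1)
    rw [← Finset.card_image_of_injOn hi2]
    by_contra hlt
    apply hf0
    refine poly_zero_of_roots hfd ((T.filter (fun τ => f.eval (cs σ τ) = 0)).image (cs σ)) (by omega) ?_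
    intro s hs
    obtain ⟨τ, hτ, rfl⟩ := Finset.mem_image.mp hs
    exact (Finset.mem_filter.mp hτ).2
  have hnz : ((T.filter (fun τ => ¬ f.eval (cs σ τ) = 0)).card : ℝ) ≤ k := by
    refine le_trans (Nat.cast_le.mpr (Finset.card_le_card ?_)) (hline σ (hUp hσ) α β)
    intro τ hτ
    simp only [hT, Finset.mem_filter] at hτ ⊢
    refine ⟨hτ.1.1, hτ.1.2.1, ?_⟩
    have h := hE σ τ hτ.1.2.1
    exact hfl τ (cs σ τ) h.1 hτ.1.2.2 (rpt_cs h.1 h.2) hτ.2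
  have : (T.card : ℝ) ≤ D + k := by
    rw [← hsplit]; push_cast
    have : ((T.filter (fun τ => f.eval (cs σ τ) = 0)).card : ℝ) ≤ D := by exact_mod_cast hz
    linarith
  linarith

theorem core {F : Type*} [Field F] {p : ℕ} [CharP F p] (E : F × F × F → F × F × F → Prop)
    (U V : Finset (F × F × F))
    (hE : ∀ σ τ, E σ τ → σ.1 ≠ τ.1 ∧ τ.2.2 - σ.2.2 = σ.1 * τ.2.1 - τ.1 * σ.2.1)
    (hinjU : ∀ σ ∈ U, Set.InjOn (cs σ) (V.filter (fun τ => E σ τ) : Finset _))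
    (hinjV : ∀ τ ∈ V, Set.InjOn (cs τ) (U.filter (fun σ => E σ τ) : Finset _))
    (n K k Δ : ℝ) (D h Δ0 : ℕ) (hUn : (U.card : ℝ) ≤ n) (hVn : (V.card : ℝ) ≤ n)
    (hK : ∀ σ ∈ U, ((V.filter (fun τ => E σ τ)).card : ℝ) ≤ K)
    (hline : ∀ σ ∈ U, ∀ α β : F, ((V.filter (fun τ => E σ τ ∧
      α * (τ.2.1 - σ.2.1) + β * (σ.1 - τ.1) = 1)).card : ℝ) ≤ k)
    (hD : 1 ≤ D) (hDp : 2 * D + 2 < p) (hΔ : 32 * D < Δ) (hΔk : k < Δ / 8 - D)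
    (hΔ0 : 2 * (D + 1) ≤ Δ0) (hh : 4 * (D + 1) * n < h * Δ0) (hhD : 6 * h < (D + 2) * (D + 3))
    (hK0 : 0 ≤ K)
    (he : 16 * D ^ 2 * K < (ec E U V - Δ0 * n) / 2 - 2 * n * Δ) : False := by
  have hn0 : 0 ≤ n := le_trans (Nat.cast_nonneg _) hUn
  set V0 := V.filter (fun τ => Δ0 ≤ (U.filter (fun σ => E σ τ)).card) with hV0
  have hV0sub : V0 ⊆ V := Finset.filter_subset _ _
  have hV0sum : (ec E U V : ℝ) - Δ0 * n ≤ ∑ τ ∈ V0, ((U.filter (fun σ => E σ τ)).card : ℝ) := by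
    rw [ec_comm]; push_cast
    rw [← Finset.sum_filter_add_sum_filter_not V (fun τ => Δ0 ≤ (U.filter (fun σ => E σ τ)).card), ← hV0]
    have : ∑ τ ∈ V.filter (fun τ => ¬ Δ0 ≤ (U.filter (fun σ => E σ τ)).card),
        ((U.filter (fun σ => E σ τ)).card : ℝ) ≤ Δ0 * n := by
      refine (Finset.sum_le_card_nsmul _ _ (Δ0 : ℝ) fun τ hτ => ?_).trans ?_
      · have := (Finset.mem_filter.mp hτ).2
        exact_mod_cast (not_le.mp this).le
      · rw [nsmul_eq_mul, mul_comm]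
        refine mul_le_mul_of_nonneg_left (le_trans ?_ hVn) (by positivity)
        exact_mod_cast Finset.card_le_card (Finset.filter_subset _ _)
    linarith
  have hh' : 4 * (D + 1) * U.card < h * Δ0 := by
    have : (4 * (D + 1) * U.card : ℝ) < h * Δ0 := by
      refine lt_of_le_of_lt ?_ hh
      gcongr
    exact_mod_cast this
  obtain ⟨S, hSU, hSh, hSw⟩ := greedy E U V0 Δ0 D h hΔ0 (fun τ hτ => (Finset.mem_filter.mp hτ).2)
    (fun τ => ((U.filter (fun σ => E σ τ)).card : ℝ)) (fun _ => by positivity) hh'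
  set V2 := V0.filter (fun τ => D + 1 ≤ (S.filter (fun σ => E σ τ)).card) with hV2
  have hV2V : V2 ⊆ V := (Finset.filter_subset _ _).trans hV0sub
  have hec2 : ((ec E U V : ℝ) - Δ0 * n) / 2 ≤ ec E U V2 := by
    rw [ec_comm E U V2]; push_cast
    linarith
  obtain ⟨G0, hG00, hG0D, hG0S⟩ := interpolate S D (by
    have h1 : 6 * S.card < (D + 2) * (D + 3) := by omega
    have := Nat.mul_lt_mul_of_pos_left h1 (Nat.succ_pos D)
    calc 6 * (S.card * (D + 1)) = (D + 1) * (6 * S.card) := by ring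
      _ < (D + 1) * ((D + 2) * (D + 3)) := this
      _ = _ := by ring)
  have hV2z : ∀ τ ∈ V2, rho τ G0 = 0 := by
    intro τ hτ
    by_contra hne
    have h2 := (Finset.mem_filter.mp hτ).2
    have := ray_roots G0 τ hne (S.filter (fun σ => E σ τ)) (by
      intro σ hσ
      rw [Finset.mem_filter] at hσ
      refine ⟨hG0S σ hσ.1, ?_⟩
      rw [cs_comm]; exact (rpt_cs (hE σ τ hσ.2).1 (hE σ τ hσ.2).2).symm) (by
      refine (hinjV τ (hV2V hτ)).mono ?_
      intro σ hσ
      simp only [Finset.coe_filter, Set.mem_ofPred_eq] at hσ ⊢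
      exact ⟨hSU hσ.1, hσ.2⟩)
    omega
  obtain ⟨U3, hU3, V3, hV3, hdU, hdV, hpr⟩ := prune E U V2 Δ Δ
  have hDpos : (1 : ℝ) ≤ D := by exact_mod_cast hD
  have hec3 : (16 * D ^ 2 * K : ℝ) < ec E U3 V3 := by
    have a1 : (V2.card : ℝ) ≤ n := le_trans (by exact_mod_cast Finset.card_le_card hV2V) hVn
    have a2 : Δ * U.card ≤ Δ * n := by
      refine mul_le_mul_of_nonneg_left hUn (by linarith)
    have a3 : Δ * V2.card ≤ Δ * n := by
      refine mul_le_mul_of_nonneg_left a1 (by linarith)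
    have a4 : 0 ≤ Δ * U3.card := mul_nonneg (by linarith) (by positivity)
    have a5 : 0 ≤ Δ * V3.card := mul_nonneg (by linarith) (by positivity)
    linarith
  have hU3z : ∀ σ ∈ U3, rho σ G0 = 0 := by
    intro σ hσ
    by_contra hne
    have := ray_roots G0 σ hne (V3.filter (fun τ => E σ τ)) (by
      intro τ hτ
      rw [Finset.mem_filter] at hτ
      exact ⟨hV2z τ (hV3 hτ.1), rpt_cs (hE σ τ hτ.2).1 (hE σ τ hτ.2).2⟩) (by
      refine (hinjU σ (hU3 hσ)).mono ?_
      intro τ hτ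
      simp only [Finset.coe_filter, Set.mem_ofPred_eq] at hτ ⊢
      exact ⟨hV2V (hV3 hτ.1), hτ.2⟩)
    have h1 := hdU σ hσ
    have h2 : ((V3.filter (fun τ => E σ τ)).card : ℝ) ≤ D := by exact_mod_cast this.trans hG0D
    linarith
  have hU3ne : U3.Nonempty := by
    rw [Finset.nonempty_iff_ne_empty]
    rintro rfl
    have : (0 : ℝ) ≤ 16 * D ^ 2 * K := by positivity
    simp [ec] at hec3
    linarith
  have hfmono : ∀ (P : F × F × F → Prop), (V3.filter P).card ≤ (V.filter P).card := fun P =>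
    Finset.card_le_card (Finset.filter_subset_filter _ (hV3.trans hV2V))
  obtain ⟨G, hGirr, hGD, Up, hUp, hUp2, hUp3⟩ := core2 E U3 V3
    (fun σ τ h => rpt_cs (hE σ τ h).1 (hE σ τ h).2)
    (fun τ hτ => (hinjV τ (hV2V (hV3 hτ))).mono (by
      intro σ hσ
      simp only [Finset.coe_filter, Set.mem_ofPred_eq] at hσ ⊢
      exact ⟨hU3 hσ.1, hσ.2⟩)) G0 hG00 D hD hG0D hU3z hU3ne Δ (by linarith) hdU hdV K
    (fun σ hσ => le_trans (Nat.cast_le.mpr (hfmono _)) (hK σ (hU3 hσ)))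
  refine core3 (p := p) E U3 V3 hE (fun σ hσ => (hinjU σ (hU3 hσ)).mono (by
      intro τ hτ
      simp only [Finset.coe_filter, Set.mem_ofPred_eq] at hτ ⊢
      exact ⟨hV2V (hV3 hτ.1), hτ.2⟩)) D hDp Δ k hΔ hΔk
    (fun σ hσ α β => le_trans (Nat.cast_le.mpr
      (Finset.card_le_card (Finset.filter_subset_filter _ (hV3.trans hV2V)))) (hline σ (hU3 hσ) α β))
    G hGirr hGD Up hUp hUp2 ?_
  -- cardinality
  have hdpos : (0 : ℝ) < G.totalDegree := by exact_mod_cast totalDegree_pos_of_irred hGirr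
  have hdD : (G.totalDegree : ℝ) ≤ D := by exact_mod_cast hGD
  have h1 : 16 * (D : ℝ) ^ 2 * K * G.totalDegree < 4 * D * K * Up.card :=
    lt_of_lt_of_le (mul_lt_mul_of_pos_right hec3 hdpos) hUp3
  have hKpos : 0 < K := by
    rcases hK0.eq_or_lt with h | h
    · rw [← h] at h1; simp at h1
    · exact h
  have h2 : (4 * D * G.totalDegree : ℝ) < Up.card := by
    have h4 : (0 : ℝ) < 4 * D * K := by positivity
    have : (4 * D * K : ℝ) * (4 * D * G.totalDegree) < 4 * D * K * Up.card := by
      calc (4 * D * K : ℝ) * (4 * D * G.totalDegree) = 16 * (D : ℝ) ^ 2 * K * G.totalDegree := by ring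
        _ < _ := h1
    exact lt_of_mul_lt_mul_left this h4.le
  have h3 : (4 * (G.totalDegree * G.totalDegree) : ℝ) < Up.card := by nlinarith
  exact_mod_cast h3
end Core3


section Simple

/-- the bilinear meeting relation -/
def Mrel {F : Type*} [Field F] (σ τ : F × F × F) : Prop :=
  τ.2.2 - σ.2.2 = σ.1 * τ.2.1 - τ.1 * σ.2.1

def CR {F : Type*} [Field F] (σ τ : F × F × F) : Prop := σ.1 ≠ τ.1 ∧ Mrel σ τ

def SE {F : Type*} [Field F] (U V : Finset (F × F × F)) (σ τ : F × F × F) : Prop :=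
  CR σ τ ∧ (∀ σ' ∈ U, rpt σ' (cs σ τ) = rpt σ (cs σ τ) → σ' = σ) ∧
    (∀ τ' ∈ V, rpt τ' (cs σ τ) = rpt σ (cs σ τ) → τ' = τ)

lemma SE_injU {F : Type*} [Field F] (U V : Finset (F × F × F)) :
    ∀ σ ∈ U, Set.InjOn (cs σ) (V.filter (fun τ => SE U V σ τ) : Finset _) := by
  intro σ _ τ hτ τ' hτ' h
  simp only [Finset.coe_filter, Set.mem_ofPred_eq] at hτ hτ'
  have h1 := rpt_cs hτ.2.1.1 hτ.2.1.2
  rw [h] at h1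
  exact hτ'.2.2.2 τ hτ.1 h1.symm

lemma SE_injV {F : Type*} [Field F] (U V : Finset (F × F × F)) :
    ∀ τ ∈ V, Set.InjOn (cs τ) (U.filter (fun σ => SE U V σ τ) : Finset _) := by
  intro τ _ σ hσ σ' hσ' h
  simp only [Finset.coe_filter, Set.mem_ofPred_eq] at hσ hσ'
  rw [cs_comm τ σ, cs_comm τ σ'] at h
  have h1 := rpt_cs hσ.2.1.1 hσ.2.1.2
  have h2 := rpt_cs hσ'.2.1.1 hσ'.2.1.2
  rw [h] at h1
  exact hσ'.2.2.1 σ hσ.1 (h1.trans h2.symm)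

lemma two_rays {F : Type*} [Field F] {σ σ' : F × F × F} (hne : σ ≠ σ') {X : Fin 3 → F}
    (h1 : rpt σ (X 0) = X) (h2 : rpt σ' (X 0) = X) : CR σ σ' ∧ X 0 = cs σ σ' := by
  have ht : σ.1 ≠ σ'.1 := by
    intro ht
    apply hne
    have h := h1.trans h2.symm
    have e1 := congrFun h 1
    have e2 := congrFun h 2
    simp [rpt, ht] at e1 e2
    rw [e1] at e2
    exact Prod.ext ht (Prod.ext e1 (by simpa using e2))
  have h := (rpt_meet _ _ ht (X 0)).mp (h1.trans h2.symm)
  refine ⟨⟨ht, h.2⟩, ?_⟩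
  rw [cs, eq_div_iff (sub_ne_zero.mpr ht)]
  exact h.1

lemma within_sum {F : Type*} [Field F] [Fintype F] (U : Finset (F × F × F)) :
    ∑ X : Fin 3 → F, (U.filter (fun σ => rpt σ (X 0) = X)).offDiag.card ≤
      ec (fun σ σ' => σ ≠ σ' ∧ Mrel σ σ') U U := by
  rw [ec_eq_card]
  set P := (U ×ˢ U).filter (fun q => q.1 ≠ q.2 ∧ Mrel q.1 q.2) with hP
  calc ∑ X : Fin 3 → F, (U.filter (fun σ => rpt σ (X 0) = X)).offDiag.card
      ≤ ec (fun (X : Fin 3 → F) (q : (F × F × F) × (F × F × F)) => rpt q.1 (X 0) = X ∧ rpt q.2 (X 0) = X)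
          Finset.univ P := by
        refine Finset.sum_le_sum fun X _ => Finset.card_le_card ?_
        intro q hq
        simp only [Finset.mem_offDiag, Finset.mem_filter, hP, Finset.mem_product] at hq ⊢
        obtain ⟨⟨a1, a2⟩, ⟨b1, b2⟩, hne⟩ := hq
        exact ⟨⟨⟨a1, b1⟩, hne, (two_rays hne a2 b2).1.2⟩, a2, b2⟩
    _ ≤ P.card := by
        rw [ec_comm, Finset.card_eq_sum_ones]
        refine Finset.sum_le_sum fun q hq => ?_
        rw [Finset.card_le_one]
        intro X hX Y hY
        simp only [Finset.mem_filter, hP] at hX hY hq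
        have e1 := (two_rays hq.2.1 hX.2.1 hX.2.2).2
        have e2 := (two_rays hq.2.1 hY.2.1 hY.2.2).2
        rw [← hX.2.1, ← hY.2.1, e1, e2]
    _ ≤ _ := by
      rw [hP]
      apply le_of_eq
      congr!

lemma k_ineq (a b : ℕ) (h : 2 ≤ a ∨ 2 ≤ b) : a * b ≤ 2 * (a * a - a) + 2 * (b * b - b) := by
  have h1 : a ≤ a * a := Nat.le_mul_self a
  have h2 : b ≤ b * b := Nat.le_mul_self b
  zify [h1, h2]
  rcases h with h | h
  · have : (2 : ℤ) ≤ a := by exact_mod_cast h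
    have hb : (b : ℤ) ≤ b * b := by exact_mod_cast h2
    by_cases hab : b ≤ a
    · have : (b : ℤ) ≤ a := by exact_mod_cast hab
      nlinarith
    · have : (a : ℤ) ≤ b := by exact_mod_cast (not_le.mp hab).le
      nlinarith
  · have : (2 : ℤ) ≤ b := by exact_mod_cast h
    have hb : (a : ℤ) ≤ a * a := by exact_mod_cast h1
    by_cases hab : b ≤ a
    · have : (b : ℤ) ≤ a := by exact_mod_cast hab
      nlinarith
    · have : (a : ℤ) ≤ b := by exact_mod_cast (not_le.mp hab).le
      nlinarith

lemma simple_edges {F : Type*} [Field F] [Fintype F] (U V : Finset (F × F × F)) :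
    ec CR U V ≤ ec (SE U V) U V + 2 * (ec (fun σ σ' => σ ≠ σ' ∧ Mrel σ σ') U U +
      ec (fun σ σ' => σ ≠ σ' ∧ Mrel σ σ') V V) := by
  set NS := (U ×ˢ V).filter (fun q => CR q.1 q.2 ∧ ¬ SE U V q.1 q.2) with hNS
  have h1 : ec CR U V ≤ ec (SE U V) U V + NS.card := by
    rw [ec_eq_card, ec_eq_card]
    refine le_trans (Finset.card_le_card ?_) (Finset.card_union_le _ _)
    intro q hq
    simp only [Finset.mem_filter, Finset.mem_union, hNS] at hq ⊢
    tauto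
  refine h1.trans (Nat.add_le_add_left ?_ _)
  rw [Finset.card_eq_sum_card_fiberwise (f := fun q => rpt q.1 (cs q.1 q.2)) (t := Finset.univ) (by
    intro q _; simp)]
  have h2 : ∀ X : Fin 3 → F, (NS.filter (fun q => rpt q.1 (cs q.1 q.2) = X)).card ≤
      2 * (U.filter (fun σ => rpt σ (X 0) = X)).offDiag.card +
      2 * (V.filter (fun σ => rpt σ (X 0) = X)).offDiag.card := by
    intro X
    rcases Finset.eq_empty_or_nonempty (NS.filter (fun q => rpt q.1 (cs q.1 q.2) = X)) with he | ⟨q, hq⟩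
    · rw [he]; simp
    have key : ∀ q ∈ NS.filter (fun q => rpt q.1 (cs q.1 q.2) = X), X 0 = cs q.1 q.2 ∧
        q.1 ∈ U.filter (fun σ => rpt σ (X 0) = X) ∧ q.2 ∈ V.filter (fun σ => rpt σ (X 0) = X) := by
      intro q hq
      simp only [hNS, Finset.mem_filter, Finset.mem_product] at hq ⊢
      obtain ⟨⟨⟨hu, hv⟩, hc, hs⟩, hX⟩ := hq
      have hX0 : X 0 = cs q.1 q.2 := by rw [← hX]; rfl
      refine ⟨hX0, ⟨hu, by rw [hX0]; exact hX⟩, hv, ?_⟩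
      rw [hX0, ← rpt_cs hc.1 hc.2]; exact hX
    have hle : (NS.filter (fun q => rpt q.1 (cs q.1 q.2) = X)).card ≤
        (U.filter (fun σ => rpt σ (X 0) = X)).card * (V.filter (fun σ => rpt σ (X 0) = X)).card := by
      rw [← Finset.card_product]
      refine Finset.card_le_card fun q hq => ?_
      rw [Finset.mem_product]
      exact (key q hq).2
    refine hle.trans ?_
    rw [Finset.offDiag_card, Finset.offDiag_card]
    apply k_ineq
    obtain ⟨hX0, hqU, hqV⟩ := key q hq
    simp only [hNS, Finset.mem_filter, Finset.mem_product] at hq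
    obtain ⟨⟨⟨hu, hv⟩, hc, hs⟩, hX⟩ := hq
    by_contra hcon
    push Not at hcon
    apply hs
    refine ⟨hc, ?_, ?_⟩
    · intro σ' hσ' h
      have : σ' ∈ U.filter (fun σ => rpt σ (X 0) = X) := by
        rw [Finset.mem_filter]; exact ⟨hσ', by rw [hX0, h, hX]⟩
      exact Finset.card_le_one.mp (by omega) _ this _ hqU
    · intro τ' hτ' h
      have : τ' ∈ V.filter (fun σ => rpt σ (X 0) = X) := by
        rw [Finset.mem_filter]; exact ⟨hτ', by rw [hX0, h, hX]⟩
      exact Finset.card_le_one.mp (by omega) _ this _ hqV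
  refine (Finset.sum_le_sum fun X _ => h2 X).trans ?_
  rw [Finset.sum_add_distrib, ← Finset.mul_sum, ← Finset.mul_sum, mul_add]
  exact Nat.add_le_add (Nat.mul_le_mul_left _ (within_sum U)) (Nat.mul_le_mul_left _ (within_sum V))
end Simple


section Fam

lemma ec_image {α β α' β' : Type*} [DecidableEq α'] [DecidableEq β'] (r : α' → β' → Prop) (f : α → α') (g : β → β')
    (hf : Function.Injective f) (hg : Function.Injective g) (U : Finset α) (V : Finset β) :
    ec r (U.image f) (V.image g) = ec (fun a b => r (f a) (g b)) U V := by
  unfold ec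
  rw [Finset.sum_image (fun a _ b _ h => hf h)]
  refine Finset.sum_congr rfl fun a _ => ?_
  rw [Finset.filter_image, Finset.card_image_of_injective _ hg]

lemma avg_lam {F α : Type*} [Fintype F] (R : F → α → α → Prop) (Dg : α → α → Prop) (Ω : Finset α)
    (Bc : ℕ) (h1 : ∀ l, ∀ i ∈ Ω, (Ω.filter (fun j => R l i j ∧ Dg i j)).card ≤ Bc)
    (h2 : ∀ i j, ¬ Dg i j → ∀ l l', R l i j → R l' i j → l = l') :
    ∑ l : F, ec (R l) Ω Ω ≤ Fintype.card F * (Ω.card * Bc) + Ω.card * Ω.card := by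
  have e1 : ∀ l, ec (R l) Ω Ω ≤ Ω.card * Bc +
      ((Ω ×ˢ Ω).filter (fun q => R l q.1 q.2 ∧ ¬ Dg q.1 q.2)).card := by
    intro l
    have e2 : ec (R l) Ω Ω ≤ ec (fun i j => R l i j ∧ Dg i j) Ω Ω +
      ((Ω ×ˢ Ω).filter (fun q => R l q.1 q.2 ∧ ¬ Dg q.1 q.2)).card := by
      rw [ec_eq_card, ec_eq_card]
      refine le_trans (Finset.card_le_card ?_) (Finset.card_union_le _ _)
      intro q hq
      simp only [Finset.mem_filter, Finset.mem_union] at hq ⊢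
      tauto
    refine e2.trans (Nat.add_le_add_right ?_ _)
    unfold ec
    rw [← smul_eq_mul]
    refine Finset.sum_le_card_nsmul _ _ _ fun i hi => ?_
    refine le_trans (le_of_eq ?_) (h1 l i hi)
    congr!
  refine (Finset.sum_le_sum fun l _ => e1 l).trans ?_
  rw [Finset.sum_add_distrib, Finset.sum_const, Finset.card_univ, smul_eq_mul]
  refine Nat.add_le_add_left ?_ _
  have e3 : ∑ l : F, ((Ω ×ˢ Ω).filter (fun q => R l q.1 q.2 ∧ ¬ Dg q.1 q.2)).card =
    ec (fun (l : F) (q : α × α) => R l q.1 q.2 ∧ ¬ Dg q.1 q.2) Finset.univ (Ω ×ˢ Ω) := by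
    unfold ec
    refine Finset.sum_congr rfl fun l _ => ?_
    congr!
  rw [e3, ec_comm, ← Finset.card_product, Finset.card_eq_sum_ones]
  refine Finset.sum_le_sum fun q _ => ?_
  rw [Finset.card_le_one]
  intro l hl l' hl'
  simp only [Finset.mem_filter] at hl hl'
  exact h2 _ _ hl.2.2 l l' hl.2.1 hl'.2.1

def fam1 {F : Type*} [Field F] (l : F) (i : F × F × F) : F × F × F := (i.1 + l, i.2.1, - i.2.2)
def fam2 {F : Type*} [Field F] (l : F) (i : F × F × F) : F × F × F := (i.1, i.2.1, - i.2.2 + l * i.2.1)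

lemma fam1_inj {F : Type*} [Field F] (l : F) : Function.Injective (fam1 l) := by
  rintro ⟨a, b, c⟩ ⟨a', b', c'⟩ h
  simp only [fam1, Prod.mk.injEq, add_left_inj, neg_inj] at h
  rw [h.1, h.2.1, h.2.2]

lemma fam2_inj {F : Type*} [Field F] (l : F) : Function.Injective (fam2 l) := by
  rintro ⟨a, b, c⟩ ⟨a', b', c'⟩ h
  simp only [fam2, Prod.mk.injEq] at h
  obtain ⟨rfl, rfl, h⟩ := h
  simpa using h

def Qrel {F : Type*} [Field F] (i j : F × F × F) : Prop :=
  i.2.1 * j.1 + i.2.2 = j.2.1 * i.1 + j.2.2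

lemma Mrel_fam {F : Type*} [Field F] (l : F) (i j : F × F × F) :
    Mrel (fam1 l i) (fam2 l j) ↔ Qrel i j := by
  simp only [Mrel, fam1, fam2, Qrel]
  constructor <;> intro h <;> linear_combination h

lemma exists_lam {F : Type*} [Field F] [Fintype F] (B : Finset F) (L : Finset (F × F)) :
    ∃ l : F, Fintype.card F * (ec (fun i j => fam1 l i ≠ fam1 l j ∧ Mrel (fam1 l i) (fam1 l j)) (B ×ˢ L) (B ×ˢ L) +
      ec (fun i j => fam2 l i ≠ fam2 l j ∧ Mrel (fam2 l i) (fam2 l j)) (B ×ˢ L) (B ×ˢ L)) ≤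
      2 * (Fintype.card F * ((B ×ˢ L).card * B.card) + (B ×ˢ L).card * (B ×ˢ L).card) := by
  set Ω := B ×ˢ L with hΩ
  have a1 := avg_lam (F := F) (fun l i j => fam1 l i ≠ fam1 l j ∧ Mrel (fam1 l i) (fam1 l j))
    (fun i j => i.2.1 = j.2.1) Ω B.card (by
      intro l i hi
      refine Finset.card_le_card_of_injOn Prod.fst ?_ ?_
      · intro j hj
        simp only [Finset.coe_filter, Set.mem_ofPred_eq, hΩ, Finset.mem_product] at hj
        exact hj.1.1
      · intro j hj j' hj' h
        simp only [Finset.coe_filter, Set.mem_ofPred_eq] at hj hj'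
        have e1 := hj.2.1.2
        have e2 := hj'.2.1.2
        simp only [Mrel, fam1] at e1 e2
        have hm : j.2.1 = j'.2.1 := hj.2.2.symm.trans hj'.2.2
        rw [← h, ← hm] at e2
        exact Prod.ext h (Prod.ext hm (by linear_combination e2 - e1))) (by
      intro i j hne l l' h h'
      have e1 := h.2
      have e2 := h'.2
      simp only [Mrel, fam1] at e1 e2
      have h3 : (l - l') * (j.2.1 - i.2.1) = 0 := by linear_combination e2 - e1
      rcases mul_eq_zero.mp h3 with h4 | h4
      · exact sub_eq_zero.mp h4
      · exact absurd (sub_eq_zero.mp h4).symm hne)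
  have a2 := avg_lam (F := F) (fun l i j => fam2 l i ≠ fam2 l j ∧ Mrel (fam2 l i) (fam2 l j))
    (fun i j => i.2.1 = j.2.1) Ω B.card (by
      intro l i hi
      refine Finset.card_le_card_of_injOn Prod.fst ?_ ?_
      · intro j hj
        simp only [Finset.coe_filter, Set.mem_ofPred_eq, hΩ, Finset.mem_product] at hj
        exact hj.1.1
      · intro j hj j' hj' h
        simp only [Finset.coe_filter, Set.mem_ofPred_eq] at hj hj'
        have e1 := hj.2.1.2
        have e2 := hj'.2.1.2
        simp only [Mrel, fam2] at e1 e2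
        have hm : j.2.1 = j'.2.1 := hj.2.2.symm.trans hj'.2.2
        rw [← h, ← hm] at e2
        exact Prod.ext h (Prod.ext hm (by linear_combination e2 - e1))) (by
      intro i j hne l l' h h'
      have e1 := h.2
      have e2 := h'.2
      simp only [Mrel, fam2] at e1 e2
      have h3 : (l - l') * (j.2.1 - i.2.1) = 0 := by linear_combination e1 - e2
      rcases mul_eq_zero.mp h3 with h4 | h4
      · exact sub_eq_zero.mp h4
      · exact absurd (sub_eq_zero.mp h4).symm hne)
  by_contra hcon
  push Not at hcon
  have hs : ∑ l : F, (2 * (Fintype.card F * (Ω.card * B.card) + Ω.card * Ω.card)) <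
    ∑ l : F, Fintype.card F * (ec (fun i j => fam1 l i ≠ fam1 l j ∧ Mrel (fam1 l i) (fam1 l j)) Ω Ω +
      ec (fun i j => fam2 l i ≠ fam2 l j ∧ Mrel (fam2 l i) (fam2 l j)) Ω Ω) :=
    Finset.sum_lt_sum_of_nonempty Finset.univ_nonempty fun l _ => hcon l
  rw [Finset.sum_const, Finset.card_univ, smul_eq_mul, ← Finset.mul_sum, Finset.sum_add_distrib] at hs
  have := lt_of_mul_lt_mul_left hs (Nat.zero_le _)
  omega

lemma deg_bound {F : Type*} [Field F] (B : Finset F) (L : Finset (F × F)) (k : ℝ) (hB : (B.card : ℝ) ≤ k)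
    (hBP : ∀ x y : F, ((L.filter (fun q => q.1 * x + q.2 = y)).card : ℝ) ≤ k) (i : F × F × F) :
    (((B ×ˢ L).filter (fun j => Qrel i j)).card : ℝ) ≤ k ^ 2 := by
  have hk : 0 ≤ k := le_trans (by positivity) hB
  rw [Finset.card_eq_sum_card_fiberwise (f := Prod.fst) (t := B) (by
    intro j hj
    simp only [Finset.mem_coe, Finset.mem_filter, Finset.mem_product] at hj
    exact hj.1.1)]
  push_cast
  refine (Finset.sum_le_card_nsmul _ _ k fun b _ => ?_).trans ?_
  · refine le_trans (Nat.cast_le.mpr ?_) (hBP i.1 (i.2.1 * b + i.2.2))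
    refine Finset.card_le_card_of_injOn Prod.snd ?_ ?_
    · intro j hj
      simp only [Finset.mem_coe, Finset.mem_filter, Finset.mem_product] at hj ⊢
      simp only [Qrel] at hj ⊢
      refine ⟨hj.1.1.2, ?_⟩
      rw [← hj.2, hj.1.2]
    · intro j hj j' hj' h
      simp only [Finset.mem_coe, Finset.mem_filter, Finset.mem_filter] at hj hj'
      exact Prod.ext (hj.2.trans hj'.2.symm) h
  · rw [nsmul_eq_mul]; nlinarith

lemma edges_lower {F : Type*} [Field F] [Fintype F] (B : Finset F) (L : Finset (F × F)) (k : ℝ)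
    (hB : (B.card : ℝ) ≤ k)
    (hBP : ∀ x y : F, ((L.filter (fun q => q.1 * x + q.2 = y)).card : ℝ) ≤ k) (l : F)
    (n : ℝ) (hn : ((B ×ˢ L).card : ℝ) ≤ n) :
    (ec Qrel (B ×ˢ L) (B ×ˢ L) : ℝ) ≤
      ec CR ((B ×ˢ L).image (fam1 l)) ((B ×ˢ L).image (fam2 l)) + n * k := by
  have hk : 0 ≤ k := le_trans (by positivity) hB
  rw [ec_image _ _ _ (fam1_inj l) (fam2_inj l)]
  have e1 : ec Qrel (B ×ˢ L) (B ×ˢ L) ≤ ec (fun a b => CR (fam1 l a) (fam2 l b)) (B ×ˢ L) (B ×ˢ L) +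
     ec (fun a b => Qrel a b ∧ a.1 + l = b.1) (B ×ˢ L) (B ×ˢ L) := by
    rw [ec_eq_card, ec_eq_card, ec_eq_card]
    refine le_trans (Finset.card_le_card ?_) (Finset.card_union_le _ _)
    intro q hq
    simp only [Finset.mem_filter, Finset.mem_union, CR, Mrel_fam] at hq ⊢
    simp only [fam1, fam2]
    tauto
  have e2 : (ec (fun a b => Qrel a b ∧ a.1 + l = b.1) (B ×ˢ L) (B ×ˢ L) : ℝ) ≤ n * k := by
    unfold ec
    push_cast
    refine (Finset.sum_le_card_nsmul _ _ k fun i _ => ?_).trans ?_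
    · refine le_trans (Nat.cast_le.mpr ?_) (hBP i.1 (i.2.1 * (i.1 + l) + i.2.2))
      refine Finset.card_le_card_of_injOn Prod.snd ?_ ?_
      · intro j hj
        simp only [Finset.mem_coe, Finset.mem_filter, Finset.mem_product] at hj ⊢
        simp only [Qrel] at hj ⊢
        refine ⟨hj.1.2, ?_⟩
        rw [← hj.2.1, hj.2.2]
      · intro j hj j' hj' h
        simp only [Finset.mem_coe, Finset.mem_filter] at hj hj'
        exact Prod.ext (hj.2.2.symm.trans hj'.2.2) h
    · rw [nsmul_eq_mul]
      exact mul_le_mul_of_nonneg_right hn hk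
  have : (ec Qrel (B ×ˢ L) (B ×ˢ L) : ℝ) ≤ ec (fun a b => CR (fam1 l a) (fam2 l b)) (B ×ˢ L) (B ×ˢ L) +
     ec (fun a b => Qrel a b ∧ a.1 + l = b.1) (B ×ˢ L) (B ×ˢ L) := by exact_mod_cast e1
  linarith

lemma line_bound {F : Type*} [Field F] (B : Finset F) (L : Finset (F × F)) (k : ℝ)
    (hB : (B.card : ℝ) ≤ k)
    (hBP : ∀ x y : F, ((L.filter (fun q => q.1 * x + q.2 = y)).card : ℝ) ≤ k) (l : F)
    (σ : F × F × F) (α β : F) :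
    ((((B ×ˢ L).image (fam2 l)).filter (fun τ => Mrel σ τ ∧
      α * (τ.2.1 - σ.2.1) + β * (σ.1 - τ.1) = 1)).card : ℝ) ≤ k := by
  rw [Finset.filter_image, Finset.card_image_of_injective _ (fam2_inj l)]
  by_cases hα : α = 0
  · subst hα
    by_cases hβ : β = 0
    · subst hβ
      simp
      exact le_trans (by positivity) hB
    · refine le_trans (Nat.cast_le.mpr ?_) (hBP (σ.1 - l) ((σ.1 - β⁻¹) * σ.2.1 - σ.2.2))
      have hb : ∀ b : F, β * (σ.1 - b) = 1 → b = σ.1 - β⁻¹ := by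
        intro b h
        have h2 : σ.1 - b = β⁻¹ := eq_inv_of_mul_eq_one_right h
        linear_combination -h2
      refine Finset.card_le_card_of_injOn Prod.snd ?_ ?_
      · intro j hj
        simp only [Finset.mem_coe, Finset.mem_filter, Finset.mem_product] at hj ⊢
        simp only [Mrel, fam2] at hj ⊢
        refine ⟨hj.1.2, ?_⟩
        have h1 := hj.2.1
        have h2 := hb j.1 (by linear_combination hj.2.2)
        rw [← h2]
        linear_combination -h1
      · intro j hj j' hj' h
        simp only [Finset.mem_coe, Finset.mem_filter, Finset.mem_product] at hj hj'
        simp only [fam2] at hj hj'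
        exact Prod.ext ((hb j.1 (by linear_combination hj.2.2)).trans
          (hb j'.1 (by linear_combination hj'.2.2)).symm) h
  · refine le_trans (Nat.cast_le.mpr ?_) hB
    refine Finset.card_le_card_of_injOn Prod.fst ?_ ?_
    · intro j hj
      simp only [Finset.mem_coe, Finset.mem_filter, Finset.mem_product] at hj
      exact hj.1.1
    · intro j hj j' hj' h
      simp only [Finset.mem_coe, Finset.mem_filter, Finset.mem_product] at hj hj'
      simp only [fam2, Mrel] at hj hj'
      have h1 := hj.2.2
      have h2 := hj'.2.2
      rw [← h] at h2
      have hm : j.2.1 = j'.2.1 := by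
        apply mul_left_cancel₀ hα
        linear_combination h1 - h2
      have h3 := hj.2.1
      have h4 := hj'.2.1
      rw [← h, ← hm] at h4
      exact Prod.ext h (Prod.ext hm (by linear_combination h4 - h3))

theorem thmA {F : Type*} [Field F] [Fintype F] {p : ℕ} [CharP F p] (hcard : Fintype.card F = p) (B : Finset F) (L : Finset (F × F)) (k : ℝ)
    (hB : (B.card : ℝ) ≤ k)
    (hBP : ∀ x y : F, ((L.filter (fun q => q.1 * x + q.2 = y)).card : ℝ) ≤ k)
    (n Δ : ℝ) (D h Δ0 : ℕ) (hn : ((B ×ˢ L).card : ℝ) ≤ n)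
    (hD : 1 ≤ D) (hDp : 2 * D + 2 < p) (hΔ : 32 * D < Δ) (hΔk : k < Δ / 8 - D)
    (hΔ0 : 2 * (D + 1) ≤ Δ0) (hh : 4 * (D + 1) * n < h * Δ0) (hhD : 6 * h < (D + 2) * (D + 3))
    (he : 16 * D ^ 2 * k ^ 2 <
      ((ec Qrel (B ×ˢ L) (B ×ˢ L) - (5 * n * k + 4 * n ^ 2 / p)) - Δ0 * n) / 2 - 2 * n * Δ) : False := by
  have hk : 0 ≤ k := le_trans (by positivity) hB
  have hn0 : 0 ≤ n := le_trans (by positivity) hn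
  obtain ⟨l, hl⟩ := exists_lam B L
  set Ω := B ×ˢ L with hΩ
  set U := Ω.image (fam1 l) with hU
  set V := Ω.image (fam2 l) with hV
  have hUc : U.card = Ω.card := Finset.card_image_of_injective _ (fam1_inj l)
  have hVc : V.card = Ω.card := Finset.card_image_of_injective _ (fam2_inj l)
  have h1 := edges_lower B L k hB hBP l n hn
  have h2 := simple_edges U V
  have hw1 := ec_image (fun σ σ' => σ ≠ σ' ∧ Mrel σ σ') _ _ (fam1_inj l) (fam1_inj l) Ω Ω
  have hw2 := ec_image (fun σ σ' => σ ≠ σ' ∧ Mrel σ σ') _ _ (fam2_inj l) (fam2_inj l) Ω Ω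
  rw [← hU] at hw1
  rw [← hV] at hw2
  rw [← hw1, ← hw2, hcard] at hl
  have hp0 : (0 : ℝ) < p := by rw [← hcard]; exact_mod_cast Fintype.card_pos
  set W := ec (fun σ σ' => σ ≠ σ' ∧ Mrel σ σ') U U + ec (fun σ σ' => σ ≠ σ' ∧ Mrel σ σ') V V with hW
  have h3 : (W : ℝ) ≤ 2 * n * k + 2 * n ^ 2 / p := by
    have hl' : (p : ℝ) * W ≤ 2 * (p * (Ω.card * B.card) + Ω.card * Ω.card) := by exact_mod_cast hl
    have a1 : (Ω.card * B.card : ℝ) ≤ n * k := by gcongr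
    have a2 : (Ω.card * Ω.card : ℝ) ≤ n * n := by gcongr
    have : (p : ℝ) * W ≤ p * (2 * n * k + 2 * n ^ 2 / p) := by
      calc (p : ℝ) * W ≤ 2 * (p * (n * k) + n * n) := by
            refine hl'.trans ?_
            gcongr
        _ = p * (2 * n * k + 2 * n ^ 2 / p) := by field_simp
    exact le_of_mul_le_mul_left this hp0
  have h2' : (ec CR U V : ℝ) ≤ ec (SE U V) U V + 2 * W := by exact_mod_cast h2
  refine core (p := p) (SE U V) U V (fun σ τ h => h.1) (SE_injU U V) (SE_injV U V) n (k ^ 2) k Δ D h Δ0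
    (by rw [hUc]; exact hn) (by rw [hVc]; exact hn) ?_ ?_ hD hDp hΔ hΔk hΔ0 hh hhD (by positivity) ?_
  · intro σ hσ
    obtain ⟨i, hi, rfl⟩ := Finset.mem_image.mp hσ
    refine le_trans (Nat.cast_le.mpr ?_) (deg_bound B L k hB hBP i)
    rw [hV, Finset.filter_image, Finset.card_image_of_injective _ (fam2_inj l)]
    refine Finset.card_le_card fun j hj => ?_
    rw [Finset.mem_filter] at hj ⊢
    exact ⟨hj.1, (Mrel_fam l i j).mp hj.2.1.2⟩
  · intro σ hσ α β
    refine le_trans (Nat.cast_le.mpr (Finset.card_le_card ?_)) (line_bound B L k hB hBP l σ α β)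
    intro τ hτ
    rw [Finset.mem_filter] at hτ ⊢
    exact ⟨hτ.1, hτ.2.1.1.2, hτ.2.2⟩
  · refine lt_of_lt_of_le he ?_
    have : 4 * n ^ 2 / p = 2 * (2 * n ^ 2 / p) := by ring
    linarith
end Fam


set_option maxHeartbeats 1600000 in
theorem thmA' {F : Type*} [Field F] [Fintype F] {p : ℕ} [CharP F p] (hcard : Fintype.card F = p)
    (B : Finset F) (L : Finset (F × F)) (κ M : ℝ) (hκ : 1 ≤ κ) (hM : 10 ^ 6 * κ ^ 39 ≤ M)
    (hp : M ^ 2 < p)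
    (hB : (B.card : ℝ) ≤ κ * M)
    (hBP : ∀ x y : F, ((L.filter (fun q => q.1 * x + q.2 = y)).card : ℝ) ≤ κ * M)
    (hL : (L.card : ℝ) ≤ M ^ 2)
    (hQ : M ^ 5 / κ ^ 11 ≤ ec Qrel (B ×ˢ L) (B ×ˢ L)) : False := by
  have hκ0 : 0 < κ := by linarith
  have hκ39 : (1 : ℝ) ≤ κ ^ 39 := one_le_pow₀ hκ
  have hM6 : 10 ^ 6 ≤ M := by linarith
  have hM0 : 0 < M := by linarith
  obtain ⟨T, hT⟩ : ∃ T, T = M ^ 2 / κ ^ 12 := ⟨_, rfl⟩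
  obtain ⟨z, hz⟩ : ∃ z, z = κ ^ 13 * M := ⟨_, rfl⟩
  obtain ⟨E, hE⟩ : ∃ E, E = M ^ 5 / κ ^ 11 := ⟨_, rfl⟩
  have hκ13 : (1 : ℝ) ≤ κ ^ 13 := one_le_pow₀ hκ
  have hz0 : 10 ^ 6 ≤ z := by rw [hz]; nlinarith
  have hTz : 10 ^ 6 * z ≤ T := by
    rw [hT, hz, le_div_iff₀ (by positivity)]
    have h1 : κ ^ 25 ≤ κ ^ 39 := pow_le_pow_right₀ hκ (by norm_num)
    have h2 : 10 ^ 6 * κ ^ 25 ≤ M := by linarith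
    calc 10 ^ 6 * (κ ^ 13 * M) * κ ^ 12 = (10 ^ 6 * κ ^ 25) * M := by ring
      _ ≤ M * M := by gcongr
      _ = M ^ 2 := by ring
  have hzT : z * T = κ * M ^ 3 := by rw [hz, hT]; field_simp
  have hnT : κ * M ^ 3 * T = E := by rw [hE, hT]; field_simp
  have hE1 : 10 ^ 6 * (κ ^ 28 * M ^ 4) ≤ E := by
    rw [hE, le_div_iff₀ (by positivity)]
    calc 10 ^ 6 * (κ ^ 28 * M ^ 4) * κ ^ 11 = (10 ^ 6 * κ ^ 39) * M ^ 4 := by ring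
      _ ≤ M * M ^ 4 := by gcongr
      _ = M ^ 5 := by ring
  have hzk : z ^ 2 * (κ * M) ^ 2 = κ ^ 28 * M ^ 4 := by rw [hz]; ring
  have hkz : κ * M ≤ z := by
    rw [hz]
    have : κ ^ 1 ≤ κ ^ 13 := pow_le_pow_right₀ hκ (by norm_num)
    rw [pow_one] at this
    gcongr
  have hzM : 10 ^ 6 * z ≤ M ^ 2 := by
    refine hTz.trans ?_
    rw [hT]
    exact div_le_self (by positivity) (one_le_pow₀ hκ)
  obtain ⟨D, hD⟩ : ∃ D : ℕ, D = ⌈120 * z⌉₊ := ⟨_, rfl⟩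
  have hD1 : 120 * z ≤ D := by rw [hD]; exact Nat.le_ceil _
  have hD2 : (D : ℝ) < 120 * z + 1 := by rw [hD]; exact Nat.ceil_lt_add_one (by positivity)
  obtain ⟨Δ0, hΔ0⟩ : ∃ D : ℕ, D = ⌊T / 4⌋₊ := ⟨_, rfl⟩
  have hΔ1 : (Δ0 : ℝ) ≤ T / 4 := by rw [hΔ0]; exact Nat.floor_le (by linarith)
  have hΔ2 : T / 4 < Δ0 + 1 := by rw [hΔ0]; exact Nat.lt_floor_add_one _
  obtain ⟨h, hh⟩ : ∃ h : ℕ, h = ⌊20 * (D + 1) * z⌋₊ + 1 := ⟨_, rfl⟩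
  have hh1 : (h : ℝ) ≤ 20 * (D + 1) * z + 1 := by
    rw [hh]; push_cast
    have := Nat.floor_le (show 0 ≤ 20 * ((D : ℝ) + 1) * z by positivity)
    linarith
  have hh2 : 20 * (D + 1) * z < h := by
    rw [hh]; push_cast; exact Nat.lt_floor_add_one _
  have hn0 : 0 ≤ κ * M ^ 3 := by positivity
  refine thmA hcard B L (κ * M) hB hBP (κ * M ^ 3) (T / 32) D h Δ0 ?_ ?_ ?_ ?_ ?_ ?_ ?_ ?_ ?_
  · rw [Finset.card_product]; push_cast
    calc (B.card : ℝ) * L.card ≤ (κ * M) * M ^ 2 := by gcongr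
      _ = _ := by ring
  · have : (1 : ℝ) ≤ D := by linarith
    exact_mod_cast this
  · have : (2 * D + 2 : ℝ) < p := by linarith
    exact_mod_cast this
  · linarith
  · linarith
  · have : (2 * (D + 1) : ℝ) ≤ Δ0 := by linarith
    exact_mod_cast this
  · have h5 : T / 5 ≤ Δ0 := by linarith
    calc 4 * ((D : ℝ) + 1) * (κ * M ^ 3) = (20 * (D + 1) * z) * (T / 5) := by rw [← hzT]; ring
      _ < h * (T / 5) := by
          apply mul_lt_mul_of_pos_right hh2; linarith
      _ ≤ h * Δ0 := by gcongr
  · have : (6 * h : ℝ) < (D + 2) * (D + 3) := by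
      have := mul_le_mul_of_nonneg_left hD1 (show (0:ℝ) ≤ D + 1 by positivity)
      nlinarith
    exact_mod_cast this
  · have hD3 : (D : ℝ) ≤ 121 * z := by linarith
    have hD4 : (D : ℝ) ^ 2 ≤ (121 * z) ^ 2 := by gcongr
    have a1 : 16 * (D : ℝ) ^ 2 * (κ * M) ^ 2 ≤ 234256 * (κ ^ 28 * M ^ 4) := by
      rw [← hzk]
      calc 16 * (D : ℝ) ^ 2 * (κ * M) ^ 2 ≤ 16 * (121 * z) ^ 2 * (κ * M) ^ 2 := by gcongr
        _ = _ := by ring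
    have a2 : Δ0 * (κ * M ^ 3) ≤ E / 4 := by
      have := mul_le_mul_of_nonneg_right hΔ1 hn0
      rw [← hnT]; linarith
    have hκ28 : κ ^ 2 ≤ κ ^ 28 := pow_le_pow_right₀ hκ (by norm_num)
    have a3 : 4 * (κ * M ^ 3) ^ 2 / p ≤ 4 * (κ ^ 28 * M ^ 4) := by
      rw [div_le_iff₀ (lt_trans (by positivity) hp)]
      calc 4 * (κ * M ^ 3) ^ 2 = 4 * (κ ^ 2 * M ^ 4) * M ^ 2 := by ring
        _ ≤ 4 * (κ ^ 28 * M ^ 4) * p := by gcongr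
    have a4 : 5 * (κ * M ^ 3) * (κ * M) ≤ 5 * (κ ^ 28 * M ^ 4) := by
      calc 5 * (κ * M ^ 3) * (κ * M) = 5 * (κ ^ 2 * M ^ 4) := by ring
        _ ≤ _ := by gcongr
    have a5 : 2 * (κ * M ^ 3) * (T / 32) = E / 16 := by rw [← hnT]; ring
    have a6 : 0 < κ ^ 28 * M ^ 4 := by positivity
    rw [← hE] at hQ
    rw [a5]
    linarith


lemma disj_bundle {α β : Type*} (r : α → β → Prop) (R : Finset α) (S : Finset β) (t : ℝ)
    (h1 : ∀ s ∈ S, t ≤ (R.filter (fun q => r q s)).card)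
    (h2 : ∀ q ∈ R, ∀ s ∈ S, ∀ s' ∈ S, r q s → r q s' → s = s') :
    S.card * t ≤ R.card := by
  have e1 : (S.card * t : ℝ) ≤ ec r R S := by
    rw [ec_comm]; push_cast
    rw [← nsmul_eq_mul]
    exact Finset.card_nsmul_le_sum _ _ _ h1
  have e2 : ec r R S ≤ R.card := by
    unfold ec
    rw [Finset.card_eq_sum_ones]
    refine Finset.sum_le_sum fun q hq => ?_
    rw [Finset.card_le_one]
    intro s hs s' hs'
    rw [Finset.mem_filter] at hs hs'
    exact h2 q hq s hs.1 s' hs'.1 hs.2 hs'.2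
  have : (ec r R S : ℝ) ≤ R.card := by exact_mod_cast e2
  linarith

lemma inc_sq {F : Type*} [Field F] (P L : Finset (F × F)) :
    (ec (fun q l : F × F => l.1 * q.1 + l.2 = q.2) P L) ^ 2 ≤
      (P.image Prod.snd).card * ec Qrel ((P.image Prod.fst) ×ˢ L) ((P.image Prod.fst) ×ˢ L) := by
  rw [ec_eq_card]
  set Inc := (P ×ˢ L).filter (fun w => w.2.1 * w.1.1 + w.2.2 = w.1.2) with hInc
  have hmem : ∀ w, w ∈ Inc ↔ (w.1 ∈ P ∧ w.2 ∈ L) ∧ w.2.1 * w.1.1 + w.2.2 = w.1.2 := by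
    intro w; rw [hInc, Finset.mem_filter, Finset.mem_product]
  clear_value Inc
  have e1 : Inc.card = ∑ a ∈ P.image Prod.snd, (Inc.filter (fun w => w.1.2 = a)).card := by
    refine Finset.card_eq_sum_card_fiberwise ?_
    intro w hw
    have := (hmem w).mp (Finset.mem_coe.mp hw)
    exact Finset.mem_coe.mpr (Finset.mem_image_of_mem _ this.1.1)
  have e2 : ∑ a ∈ P.image Prod.snd, (Inc.filter (fun w => w.1.2 = a)).card ^ 2 ≤
      ec Qrel ((P.image Prod.fst) ×ˢ L) ((P.image Prod.fst) ×ˢ L) := by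
    have e3 : ∑ a ∈ P.image Prod.snd, (Inc.filter (fun w => w.1.2 = a)).card ^ 2 =
       ((P.image Prod.snd).sigma (fun a => (Inc.filter (fun w => w.1.2 = a)) ×ˢ (Inc.filter (fun w => w.1.2 = a)))).card := by
      rw [Finset.card_sigma]
      refine Finset.sum_congr rfl fun a _ => ?_
      rw [Finset.card_product, sq]
    rw [e3, ec_eq_card]
    refine Finset.card_le_card_of_injOn (fun s => ((s.2.2.1.1, s.2.1.2), (s.2.1.1.1, s.2.2.2))) ?_ ?_
    · rintro ⟨a, w, w'⟩ hs
      rw [Finset.mem_coe, Finset.mem_sigma, Finset.mem_product, Finset.mem_filter, Finset.mem_filter, hmem, hmem] at hs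
      obtain ⟨_, ⟨⟨⟨h1, h2⟩, h3⟩, h4⟩, ⟨⟨h1', h2'⟩, h3'⟩, h4'⟩ := hs
      simp only at h1 h2 h3 h4 h1' h2' h3' h4'
      rw [Finset.mem_coe, Finset.mem_filter, Finset.mem_product, Finset.mem_product, Finset.mem_product]
      refine ⟨⟨⟨Finset.mem_image_of_mem _ h1', h2⟩, ⟨Finset.mem_image_of_mem _ h1, h2'⟩⟩, ?_⟩
      simp only [Qrel]
      rw [h3, h3', h4, h4']
    · rintro ⟨a, w, w'⟩ hs ⟨b, v, v'⟩ hs' heq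
      rw [Finset.mem_coe, Finset.mem_sigma, Finset.mem_product, Finset.mem_filter, Finset.mem_filter, hmem, hmem] at hs hs'
      obtain ⟨_, ⟨⟨⟨h1, h2⟩, h3⟩, h4⟩, ⟨⟨h1', h2'⟩, h3'⟩, h4'⟩ := hs
      obtain ⟨_, ⟨⟨⟨k1, k2⟩, k3⟩, k4⟩, ⟨⟨k1', k2'⟩, k3'⟩, k4'⟩ := hs'
      simp only at h3 h4 h3' h4' k3 k4 k3' k4'
      simp only [Prod.mk.injEq] at heq
      obtain ⟨⟨q1, q2⟩, q3, q4⟩ := heq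
      have hw : w.1.2 = v.1.2 := by rw [← h3, ← k3, q2, q3]
      have hw' : w'.1.2 = v'.1.2 := by rw [← h3', ← k3', q1, q4]
      have hwv : w = v := Prod.ext (Prod.ext q3 hw) q2
      have hwv' : w' = v' := Prod.ext (Prod.ext q1 hw') q4
      subst hwv hwv'
      have : a = b := h4.symm.trans k4
      subst this
      rfl
  rw [e1]
  refine (sq_sum_le_card_mul_sum_sq).trans ?_
  exact Nat.mul_le_mul_left _ e2

theorem thmB {F : Type*} [Field F] [Fintype F] {p : ℕ} [CharP F p] (hcard : Fintype.card F = p)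
    (P R L : Finset (F × F)) (κ M : ℝ) (hκ : 1 ≤ κ) (hM : 10 ^ 6 * κ ^ 39 ≤ M)
    (hp : M ^ 2 < p)
    (hA : ((P.image Prod.snd).card : ℝ) ≤ κ * M) (hB : ((P.image Prod.fst).card : ℝ) ≤ κ * M)
    (hL : (L.card : ℝ) ≤ M ^ 2) (hR : (R.card : ℝ) ≤ M ^ 2) (hP : M ^ 2 / κ ^ 4 ≤ P.card)
    (hdeg : ∀ q ∈ P, M / κ ≤ (L.filter (fun l : F × F => l.1 * q.1 + l.2 = q.2)).card)
    (hline : ∀ l ∈ L, M / κ + 1 ≤ (R.filter (fun q : F × F => l.1 * q.1 + l.2 = q.2)).card) : False := by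
  have hκ0 : 0 < κ := by linarith
  have hκ39 : (1 : ℝ) ≤ κ ^ 39 := one_le_pow₀ hκ
  have hM0 : 0 < M := by linarith
  refine thmA' hcard (P.image Prod.fst) L κ M hκ hM hp hB ?_ hL ?_
  · intro x y
    have := disj_bundle (fun q l : F × F => l.1 * q.1 + l.2 = q.2) (R.erase (x, y))
      (L.filter (fun q => q.1 * x + q.2 = y)) (M / κ) ?_ ?_
    · have h2 : ((R.erase (x, y)).card : ℝ) ≤ M ^ 2 :=
        le_trans (by exact_mod_cast Finset.card_erase_le) hR
      have h3 := this.trans h2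
      rw [← mul_div_assoc, div_le_iff₀ hκ0] at h3
      nlinarith
    · intro l hl
      have h1 := hline l (Finset.mem_filter.mp hl).1
      have h2 : (R.filter (fun q : F × F => l.1 * q.1 + l.2 = q.2)).card ≤
        ((R.erase (x, y)).filter (fun q : F × F => l.1 * q.1 + l.2 = q.2)).card + 1 := by
        have hsub : (R.filter (fun q : F × F => l.1 * q.1 + l.2 = q.2)).erase (x, y) ⊆
            (R.erase (x, y)).filter (fun q : F × F => l.1 * q.1 + l.2 = q.2) := by
          intro q hq
          simp only [Finset.mem_erase, Finset.mem_filter] at hq ⊢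
          tauto
        have hsub' := Finset.card_le_card hsub
        have := Finset.pred_card_le_card_erase (s := R.filter (fun q : F × F => l.1 * q.1 + l.2 = q.2)) (a := (x, y))
        omega
      have h3 : ((R.filter (fun q : F × F => l.1 * q.1 + l.2 = q.2)).card : ℝ) ≤
        ((R.erase (x, y)).filter (fun q : F × F => l.1 * q.1 + l.2 = q.2)).card + 1 := by
        exact_mod_cast h2
      linarith
    · intro q hq s hs s' hs' h h'
      have e1 := (Finset.mem_filter.mp hs).2
      have e2 := (Finset.mem_filter.mp hs').2
      have hne : q.1 ≠ x := by
        intro he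
        apply (Finset.mem_erase.mp hq).1
        refine Prod.ext he ?_
        rw [← h, he, e1]
      have h1 : (s.1 - s'.1) * (q.1 - x) = 0 := by linear_combination h - h' - e1 + e2
      have h2 : s.1 = s'.1 := by
        rcases mul_eq_zero.mp h1 with h3 | h3
        · exact sub_eq_zero.mp h3
        · exact absurd (sub_eq_zero.mp h3) hne
      refine Prod.ext h2 ?_
      rw [← h2] at h'
      linear_combination h - h'
  · have hJ : M ^ 3 / κ ^ 5 ≤ ec (fun q l : F × F => l.1 * q.1 + l.2 = q.2) P L := by
      calc M ^ 3 / κ ^ 5 = (M ^ 2 / κ ^ 4) * (M / κ) := by field_simp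
        _ ≤ P.card * (M / κ) := by gcongr
        _ ≤ _ := by
          unfold ec; push_cast
          rw [← nsmul_eq_mul]
          exact Finset.card_nsmul_le_sum _ _ _ hdeg
    have h1 := inc_sq P L
    have h2 : (ec (fun q l : F × F => l.1 * q.1 + l.2 = q.2) P L : ℝ) ^ 2 ≤
      (P.image Prod.snd).card * ec Qrel ((P.image Prod.fst) ×ˢ L) ((P.image Prod.fst) ×ˢ L) := by
      exact_mod_cast h1
    have h3 : (M ^ 3 / κ ^ 5) ^ 2 ≤ κ * M * ec Qrel ((P.image Prod.fst) ×ˢ L) ((P.image Prod.fst) ×ˢ L) := by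
      calc (M ^ 3 / κ ^ 5) ^ 2 ≤ (ec (fun q l : F × F => l.1 * q.1 + l.2 = q.2) P L : ℝ) ^ 2 := by gcongr
        _ ≤ _ := h2
        _ ≤ _ := by gcongr
    have h4 : (M ^ 3 / κ ^ 5) ^ 2 = κ * M * (M ^ 5 / κ ^ 11) := by field_simp
    rw [h4] at h3
    exact le_of_mul_le_mul_left h3 (by positivity)


lemma line_sub {F : Type*} [Field F] {l l' : Set (F × F)} (hl : IsLine l) (hl' : IsLine l') {q q' : F × F}
    (hne : q ≠ q') (h1 : q ∈ l) (h2 : q' ∈ l) (h1' : q ∈ l') (h2' : q' ∈ l') : l ⊆ l' := by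
  obtain ⟨a, b, c, hab, rfl⟩ := hl
  obtain ⟨a', b', c', hab', rfl⟩ := hl'
  intro x hx
  change _ = _ at h1 h2 h1' h2' hx
  change _ = _
  have hdet : a * b' = a' * b := by
    have k1 : (q'.1 - q.1) * (a * b' - a' * b) = 0 := by
      linear_combination b' * h2 - b' * h1 - b * h2' + b * h1'
    have k2 : (q'.2 - q.2) * (a * b' - a' * b) = 0 := by
      linear_combination a * h2' - a * h1' - a' * h2 + a' * h1
    by_contra hcon
    have k3 : a * b' - a' * b ≠ 0 := sub_ne_zero.mpr hcon
    apply hne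
    refine Prod.ext ?_ ?_
    · exact (sub_eq_zero.mp ((mul_eq_zero.mp k1).resolve_right k3)).symm
    · exact (sub_eq_zero.mp ((mul_eq_zero.mp k2).resolve_right k3)).symm
  have k1 : a * (a' * x.1 + b' * x.2 + c') = 0 := by
    linear_combination a' * hx - a' * h1 + a * h1' + (x.2 - q.2) * hdet
  have k2 : b * (a' * x.1 + b' * x.2 + c') = 0 := by
    linear_combination b' * hx - b' * h1 + b * h1' - (x.1 - q.1) * hdet
  by_contra hcon
  apply hab
  rw [(mul_eq_zero.mp k1).resolve_right hcon, (mul_eq_zero.mp k2).resolve_right hcon]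

lemma line_unique {F : Type*} [Field F] {l l' : Set (F × F)} (hl : IsLine l) (hl' : IsLine l') {q q' : F × F}
    (hne : q ≠ q') (h1 : q ∈ l) (h2 : q' ∈ l) (h1' : q ∈ l') (h2' : q' ∈ l') : l = l' :=
  Set.Subset.antisymm (line_sub hl hl' hne h1 h2 h1' h2') (line_sub hl' hl hne h1' h2' h1 h2)

lemma card_erase_real {α : Type*} [DecidableEq α] (S : Finset α) (x : α) (t : ℝ) (h : t + 1 ≤ S.card) :
    t ≤ (S.erase x).card := by
  have := Finset.pred_card_le_card_erase (s := S) (a := x)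
  have h2 : S.card ≤ (S.erase x).card + 1 := by omega
  have h3 : (S.card : ℝ) ≤ (S.erase x).card + 1 := by exact_mod_cast h2
  linarith

lemma fan {F : Type*} [Field F] (P0 : Finset (F × F)) (S : Finset (Set (F × F))) (q : F × F) (t : ℝ)
    (hS : ∀ l ∈ S, IsLine l ∧ q ∈ l ∧ t + 1 ≤ (P0.filter (fun x => x ∈ l)).card) :
    S.card * t ≤ (P0.filter (fun x => x ≠ q ∧ ∃ l ∈ S, x ∈ l)).card := by
  refine disj_bundle (fun x l => x ∈ l) _ S t ?_ ?_
  · intro l hl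
    refine (card_erase_real _ q t (hS l hl).2.2).trans ?_
    refine Nat.cast_le.mpr (Finset.card_le_card ?_)
    intro x hx
    rw [Finset.mem_erase, Finset.mem_filter] at hx
    rw [Finset.mem_filter, Finset.mem_filter]
    exact ⟨⟨hx.2.1, hx.1, l, hl, hx.2.2⟩, hx.2.2⟩
  · intro x hx l hl l' hl' h h'
    exact line_unique (hS l hl).1 (hS l' hl').1 (Finset.mem_filter.mp hx).2.1 h (hS l hl).2.1 h' (hS l' hl').2.1

def ZZ {F : Type*} [Field F] (L0 : Finset (Set (F × F))) (q p1 p2 : F × F) : Prop :=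
  p1 ≠ q ∧ p2 ≠ q ∧ ∃ l1 ∈ L0, ∃ l2 ∈ L0, q ∈ l1 ∧ p1 ∈ l1 ∧ q ∈ l2 ∧ p2 ∈ l2 ∧ l1 ≠ l2

lemma ZZ_count {F : Type*} [Field F] (P0 : Finset (F × F)) (L0 : Finset (Set (F × F))) (t : ℝ) (ht : 0 ≤ t)
    (hL : ∀ l ∈ L0, IsLine l) (h2 : ∀ l ∈ L0, t + 1 ≤ (P0.filter (fun q => q ∈ l)).card) (q : F × F)
    (h1 : t + 1 ≤ (L0.filter (fun l => q ∈ l)).card) :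
    t ^ 4 ≤ ((P0 ×ˢ P0).filter (fun w => ZZ L0 q w.1 w.2)).card := by
  set S := L0.filter (fun l => q ∈ l) with hS
  have hSm : ∀ l ∈ S, l ∈ L0 ∧ q ∈ l := fun l hl => Finset.mem_filter.mp hl
  have f1 := fan P0 S q t (fun l hl => ⟨hL l (hSm l hl).1, (hSm l hl).2, h2 l (hSm l hl).1⟩)
  set T := P0.filter (fun x => x ≠ q ∧ ∃ l ∈ S, x ∈ l) with hT
  have e0 : ((P0 ×ˢ P0).filter (fun w => ZZ L0 q w.1 w.2)).card = ec (ZZ L0 q) P0 P0 := (ec_eq_card _ _ _).symm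
  rw [e0]
  have hTsub : T ⊆ P0 := Finset.filter_subset _ _
  have e1 : ∑ x ∈ T, ((P0.filter (fun y => ZZ L0 q x y)).card : ℝ) ≤ ec (ZZ L0 q) P0 P0 := by
    unfold ec; push_cast
    exact Finset.sum_le_sum_of_subset_of_nonneg hTsub (fun _ _ _ => by positivity)
  have e2 : T.card • t ^ 2 ≤ ∑ x ∈ T, ((P0.filter (fun y => ZZ L0 q x y)).card : ℝ) := by
    refine Finset.card_nsmul_le_sum _ _ _ fun x hx => ?_
    obtain ⟨hxP, hxq, l, hl, hxl⟩ := Finset.mem_filter.mp hx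
    have f2 := fan P0 (S.erase l) q t (fun l' hl' => by
      have hl'' := hSm l' (Finset.mem_of_mem_erase hl')
      exact ⟨hL l' hl''.1, hl''.2, h2 l' hl''.1⟩)
    have f3 := card_erase_real S l t h1
    have f4 : (P0.filter (fun x => x ≠ q ∧ ∃ l' ∈ S.erase l, x ∈ l')).card ≤
      (P0.filter (fun y => ZZ L0 q x y)).card := by
      refine Finset.card_le_card fun y hy => ?_
      rw [Finset.mem_filter] at hy ⊢
      obtain ⟨hyP, hyq, l', hl', hyl'⟩ := hy
      have hl'' := hSm l' (Finset.mem_of_mem_erase hl')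
      exact ⟨hyP, hxq, hyq, l, (hSm l hl).1, l', hl''.1, (hSm l hl).2, hxl, hl''.2, hyl',
        (Finset.ne_of_mem_erase hl').symm⟩
    have f5 : ((P0.filter (fun x => x ≠ q ∧ ∃ l' ∈ S.erase l, x ∈ l')).card : ℝ) ≤
      (P0.filter (fun y => ZZ L0 q x y)).card := by exact_mod_cast f4
    have f6 : t * t ≤ (S.erase l).card * t := mul_le_mul_of_nonneg_right f3 ht
    rw [sq]; linarith
  rw [nsmul_eq_mul] at e2
  have f7 : t * t ≤ S.card * t := by gcongr; linarith
  have f8 : t ^ 4 ≤ T.card * t ^ 2 := by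
    calc t ^ 4 = (t * t) * t ^ 2 := by ring
      _ ≤ _ := by gcongr; linarith
  linarith

lemma exists_pair {F : Type*} [Field F] (P0 : Finset (F × F)) (L0 : Finset (Set (F × F))) (t : ℝ) (ht : 0 ≤ t)
    (hne : P0.Nonempty)
    (hL : ∀ l ∈ L0, IsLine l) (h2 : ∀ l ∈ L0, t + 1 ≤ (P0.filter (fun q => q ∈ l)).card)
    (h1 : ∀ q ∈ P0, t + 1 ≤ (L0.filter (fun l => q ∈ l)).card) :
    ∃ p1 ∈ P0, ∃ p2 ∈ P0, t ^ 4 ≤ P0.card * (P0.filter (fun q => ZZ L0 q p1 p2)).card := by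
  by_contra! hcon
  have a1 : P0.card • t ^ 4 ≤ ∑ q ∈ P0, (((P0 ×ˢ P0).filter (fun w => ZZ L0 q w.1 w.2)).card : ℝ) :=
    Finset.card_nsmul_le_sum _ _ _ fun q hq => ZZ_count P0 L0 t ht hL h2 q (h1 q hq)
  have a2 := ec_comm (fun (q : F × F) (w : (F × F) × (F × F)) => ZZ L0 q w.1 w.2) P0 (P0 ×ˢ P0)
  unfold ec at a2
  have a3 : ∑ q ∈ P0, (((P0 ×ˢ P0).filter (fun w => ZZ L0 q w.1 w.2)).card : ℝ) =
    ∑ w ∈ P0 ×ˢ P0, ((P0.filter (fun q => ZZ L0 q w.1 w.2)).card : ℝ) := by exact_mod_cast a2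
  have a4 : ∑ w ∈ P0 ×ˢ P0, (P0.card : ℝ) * ((P0.filter (fun q => ZZ L0 q w.1 w.2)).card : ℝ) <
    ∑ w ∈ P0 ×ˢ P0, t ^ 4 := by
    refine Finset.sum_lt_sum_of_nonempty (hne.product hne) fun w hw => ?_
    rw [Finset.mem_product] at hw
    exact hcon w.1 hw.1 w.2 hw.2
  rw [← Finset.mul_sum, ← a3, Finset.sum_const, Finset.card_product, nsmul_eq_mul] at a4
  rw [nsmul_eq_mul] at a1
  push_cast at a4
  have hc : (0 : ℝ) < P0.card := by exact_mod_cast hne.card_pos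
  nlinarith

section proj
variable {F : Type*} [Field F]

def plam (p1 p2 q : F × F) : F :=
  (p2.1 - p1.1) * (q.2 - p1.2) - (p2.2 - p1.2) * (q.1 - p1.1)

noncomputable def Phi (p1 p2 e q : F × F) : F × F :=
  ((e.1 * (q.1 - p1.1) + e.2 * (q.2 - p1.2)) / plam p1 p2 q,
   (e.1 * (q.1 - p2.1) + e.2 * (q.2 - p2.2)) / plam p1 p2 q)

noncomputable def Psi (p1 p2 e : F × F) (a b c : F) : F × F :=
  ((a * p2.1 + b * p2.2 + c) / (a * p1.1 + b * p1.2 + c),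
   (b * e.1 - a * e.2) / (a * p1.1 + b * p1.2 + c))

lemma proj_inc (p1 p2 e q : F × F) (a b c : F) (hlam : plam p1 p2 q ≠ 0)
    (hs : a * p1.1 + b * p1.2 + c ≠ 0) (hed : e.1 * (p2.1 - p1.1) + e.2 * (p2.2 - p1.2) ≠ 0) :
    (Psi p1 p2 e a b c).1 * (Phi p1 p2 e q).1 + (Psi p1 p2 e a b c).2 = (Phi p1 p2 e q).2 ↔
      a * q.1 + b * q.2 + c = 0 := by
  simp only [Psi, Phi]
  have key : (a * q.1 + b * q.2 + c) * (e.1 * (p2.1 - p1.1) + e.2 * (p2.2 - p1.2)) =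
    (a * p2.1 + b * p2.2 + c) * (e.1 * (q.1 - p1.1) + e.2 * (q.2 - p1.2)) -
    (a * p1.1 + b * p1.2 + c) * (e.1 * (q.1 - p2.1) + e.2 * (q.2 - p2.2)) +
    (b * e.1 - a * e.2) * plam p1 p2 q := by
    simp only [plam]; ring
  rw [div_mul_div_comm, div_add_div _ _ (mul_ne_zero hs hlam) hs, div_eq_div_iff (by positivity) hlam]
  constructor
  · intro h
    have h2 : (a * q.1 + b * q.2 + c) * ((e.1 * (p2.1 - p1.1) + e.2 * (p2.2 - p1.2)) *
        ((a * p1.1 + b * p1.2 + c) * plam p1 p2 q)) = 0 := by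
      linear_combination ((a * p1.1 + b * p1.2 + c) * plam p1 p2 q) * key + h
    exact (mul_eq_zero.mp h2).resolve_right (mul_ne_zero hed (mul_ne_zero hs hlam))
  · intro h
    rw [h, zero_mul] at key
    linear_combination -(((a * p1.1 + b * p1.2 + c) * plam p1 p2 q)) * key

lemma Phi_inj (p1 p2 e q q' : F × F) (hlam : plam p1 p2 q ≠ 0) (hlam' : plam p1 p2 q' ≠ 0)
    (hed : e.1 * (p2.1 - p1.1) + e.2 * (p2.2 - p1.2) ≠ 0) (h : Phi p1 p2 e q = Phi p1 p2 e q') : q = q' := by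
  simp only [Phi, Prod.mk.injEq] at h
  obtain ⟨h1, h2⟩ := h
  rw [div_eq_div_iff hlam hlam'] at h1 h2
  have h3 : (plam p1 p2 q - plam p1 p2 q') * (e.1 * (p2.1 - p1.1) + e.2 * (p2.2 - p1.2)) = 0 := by
    linear_combination h2 - h1
  have h4 : plam p1 p2 q = plam p1 p2 q' := sub_eq_zero.mp ((mul_eq_zero.mp h3).resolve_right hed)
  rw [← h4] at h1
  have h5 := mul_right_cancel₀ hlam h1
  simp only [plam] at h4
  refine Prod.ext ?_ ?_
  · apply mul_right_cancel₀ hed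
    linear_combination (p2.1 - p1.1) * h5 - e.2 * h4
  · apply mul_right_cancel₀ hed
    linear_combination (p2.2 - p1.2) * h5 + e.1 * h4

lemma Phi_fst (p1 p2 e q q' : F × F) (hlam : plam p1 p2 q ≠ 0) (hlam' : plam p1 p2 q' ≠ 0)
    (l : Set (F × F)) (hl : IsLine l) (h1 : p1 ∈ l) (h : q ∈ l) (h' : q' ∈ l) :
    (Phi p1 p2 e q).1 = (Phi p1 p2 e q').1 := by
  obtain ⟨a, b, c, hab, rfl⟩ := hl
  change _ = _ at h1 h h'
  have hdet : (q.1 - p1.1) * (q'.2 - p1.2) = (q.2 - p1.2) * (q'.1 - p1.1) := by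
    have k1 : a * ((q.1 - p1.1) * (q'.2 - p1.2) - (q.2 - p1.2) * (q'.1 - p1.1)) = 0 := by
      linear_combination (q'.2 - p1.2) * (h - h1) - (q.2 - p1.2) * (h' - h1)
    have k2 : b * ((q.1 - p1.1) * (q'.2 - p1.2) - (q.2 - p1.2) * (q'.1 - p1.1)) = 0 := by
      linear_combination (q.1 - p1.1) * (h' - h1) - (q'.1 - p1.1) * (h - h1)
    by_contra hcon
    apply hab
    have k3 := sub_ne_zero.mpr hcon
    rw [(mul_eq_zero.mp k1).resolve_right k3, (mul_eq_zero.mp k2).resolve_right k3]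
  simp only [Phi]
  rw [div_eq_div_iff hlam hlam']
  simp only [plam]
  linear_combination (e.1 * (p2.1 - p1.1) + e.2 * (p2.2 - p1.2)) * hdet

lemma Phi_snd (p1 p2 e q q' : F × F) (hlam : plam p1 p2 q ≠ 0) (hlam' : plam p1 p2 q' ≠ 0)
    (l : Set (F × F)) (hl : IsLine l) (h1 : p2 ∈ l) (h : q ∈ l) (h' : q' ∈ l) :
    (Phi p1 p2 e q).2 = (Phi p1 p2 e q').2 := by
  obtain ⟨a, b, c, hab, rfl⟩ := hl
  change _ = _ at h1 h h'
  have hdet : (q.1 - p2.1) * (q'.2 - p2.2) = (q.2 - p2.2) * (q'.1 - p2.1) := by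
    have k1 : a * ((q.1 - p2.1) * (q'.2 - p2.2) - (q.2 - p2.2) * (q'.1 - p2.1)) = 0 := by
      linear_combination (q'.2 - p2.2) * (h - h1) - (q.2 - p2.2) * (h' - h1)
    have k2 : b * ((q.1 - p2.1) * (q'.2 - p2.2) - (q.2 - p2.2) * (q'.1 - p2.1)) = 0 := by
      linear_combination (q.1 - p2.1) * (h' - h1) - (q'.1 - p2.1) * (h - h1)
    by_contra hcon
    apply hab
    have k3 := sub_ne_zero.mpr hcon
    rw [(mul_eq_zero.mp k1).resolve_right k3, (mul_eq_zero.mp k2).resolve_right k3]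
  simp only [Phi]
  rw [div_eq_div_iff hlam hlam']
  simp only [plam]
  linear_combination (e.1 * (p2.1 - p1.1) + e.2 * (p2.2 - p1.2)) * hdet

end proj


set_option maxHeartbeats 1000000 in
theorem thmC {F : Type*} [Field F] [Fintype F] {p : ℕ} [CharP F p] (hcard : Fintype.card F = p)
    (P0 : Finset (F × F)) (L0 : Finset (Set (F × F))) (κ M : ℝ) (hκ : 1 ≤ κ) (hM : 10 ^ 6 * κ ^ 39 ≤ M)
    (hp : M ^ 2 < p) (hL : ∀ l ∈ L0, IsLine l)
    (hPc : (P0.card : ℝ) ≤ M ^ 2) (hLc : (L0.card : ℝ) ≤ M ^ 2) (hne : P0.Nonempty)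
    (h1 : ∀ q ∈ P0, M / κ + 3 ≤ (L0.filter (fun l => q ∈ l)).card)
    (h2 : ∀ l ∈ L0, M / κ + 3 ≤ (P0.filter (fun q => q ∈ l)).card) : False := by
  have hκ0 : 0 < κ := by linarith
  have hκ39 : (1 : ℝ) ≤ κ ^ 39 := one_le_pow₀ hκ
  have hM0 : 0 < M := by linarith
  obtain ⟨t, ht⟩ : ∃ t, t = M / κ := ⟨_, rfl⟩
  rw [← ht] at h1 h2
  have ht0 : 0 < t := by rw [ht]; positivity
  obtain ⟨p1, hp1, p2, hp2, hcnt⟩ := exists_pair P0 L0 t ht0.le hne hL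
    (fun l hl => by have := h2 l hl; linarith) (fun q hq => by have := h1 q hq; linarith)
  set P' := P0.filter (fun q => ZZ L0 q p1 p2) with hP'
  have hP'mem : ∀ q ∈ P', q ∈ P0 ∧ ZZ L0 q p1 p2 := fun q hq => Finset.mem_filter.mp hq
  have hPpos : (0 : ℝ) < P0.card := by exact_mod_cast hne.card_pos
  have hP'card : M ^ 2 / κ ^ 4 ≤ P'.card := by
    have a1 : t ^ 4 ≤ M ^ 2 * P'.card := hcnt.trans (by gcongr)
    have a2 : t ^ 4 = M ^ 2 * (M ^ 2 / κ ^ 4) := by rw [ht]; field_simp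
    rw [a2] at a1
    exact le_of_mul_le_mul_left a1 (by positivity)
  have hP'ne : P'.Nonempty := by
    rw [← Finset.card_pos]
    have : (0 : ℝ) < P'.card := lt_of_lt_of_le (by positivity) hP'card
    exact_mod_cast this
  have hp12 : p1 ≠ p2 := by
    rintro rfl
    obtain ⟨q, hq⟩ := hP'ne
    obtain ⟨_, hq1, _, l1, hl1, l2, hl2, a1, a2, a3, a4, a5⟩ := hP'mem q hq
    exact a5 (line_unique (hL _ hl1) (hL _ hl2) hq1 a2 a1 a4 a3)
  obtain ⟨l0, hl0⟩ : ∃ l0 : Set (F × F), l0 = {x | -(p2.2 - p1.2) * x.1 + (p2.1 - p1.1) * x.2 +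
    ((p2.2 - p1.2) * p1.1 - (p2.1 - p1.1) * p1.2) = 0} := ⟨_, rfl⟩
  have hl0line : IsLine l0 := by
    refine ⟨_, _, _, ?_, hl0⟩
    intro h
    rw [Prod.mk.injEq] at h
    apply hp12
    refine Prod.ext ?_ ?_
    · linear_combination -h.2
    · linear_combination h.1
  have hl0mem : ∀ q, q ∈ l0 ↔ plam p1 p2 q = 0 := by
    intro q
    rw [hl0]
    change _ = _ ↔ _
    simp only [plam]
    constructor <;> intro h <;> linear_combination h
  have hp1l0 : p1 ∈ l0 := by rw [hl0mem]; simp only [plam]; ring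
  have hp2l0 : p2 ∈ l0 := by rw [hl0mem]; simp only [plam]; ring
  have hlam : ∀ q ∈ P', plam p1 p2 q ≠ 0 := by
    intro q hq h0
    rw [← hl0mem] at h0
    obtain ⟨_, hq1, hq2, l1, hl1, l2, hl2, a1, a2, a3, a4, a5⟩ := hP'mem q hq
    apply a5
    rw [line_unique (hL _ hl1) hl0line hq1 a2 a1 hp1l0 h0, line_unique (hL _ hl2) hl0line hq2 a4 a3 hp2l0 h0]
  obtain ⟨e, hed⟩ : ∃ e : F × F, e.1 * (p2.1 - p1.1) + e.2 * (p2.2 - p1.2) ≠ 0 := by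
    by_cases hd : p2.1 - p1.1 = 0
    · refine ⟨(0, 1), ?_⟩
      simp only [zero_mul, one_mul, zero_add]
      intro h
      exact hp12 (Prod.ext (sub_eq_zero.mp hd).symm (sub_eq_zero.mp h).symm)
    · exact ⟨(1, 0), by simpa using hd⟩
  have hw0 : ∀ l : Set (F × F), ∃ w : F × F × F, IsLine l → l = {x : F × F | w.1 * x.1 + w.2.1 * x.2 + w.2.2 = 0} := by
    intro l
    by_cases h : IsLine l
    · obtain ⟨a, b, c, _, h⟩ := h
      exact ⟨(a, b, c), fun _ => h⟩
    · exact ⟨(0, 0, 0), fun h' => absurd h' h⟩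
  choose w hw using hw0
  have hwm : ∀ l ∈ L0, ∀ x, x ∈ l ↔ (w l).1 * x.1 + (w l).2.1 * x.2 + (w l).2.2 = 0 := by
    intro l hl x
    have h := hw l (hL l hl)
    constructor
    · intro hx; rw [h] at hx; exact hx
    · intro hx; rw [h]; exact hx
  obtain ⟨ψ, hψ⟩ : ∃ ψ : Set (F × F) → F × F, ψ = fun l => Psi p1 p2 e (w l).1 (w l).2.1 (w l).2.2 := ⟨_, rfl⟩
  obtain ⟨φ, hφ⟩ : ∃ φ : F × F → F × F, φ = Phi p1 p2 e := ⟨_, rfl⟩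
  set L1 := L0.filter (fun l => p1 ∉ l) with hL1
  have hL1mem : ∀ l ∈ L1, l ∈ L0 ∧ p1 ∉ l := fun l hl => Finset.mem_filter.mp hl
  set R0 := P0.filter (fun q => plam p1 p2 q ≠ 0) with hR0
  have hR0mem : ∀ q ∈ R0, q ∈ P0 ∧ plam p1 p2 q ≠ 0 := fun q hq => Finset.mem_filter.mp hq
  have hinc : ∀ l ∈ L1, ∀ q, plam p1 p2 q ≠ 0 →
      ((ψ l).1 * (φ q).1 + (ψ l).2 = (φ q).2 ↔ q ∈ l) := by
    intro l hl q hq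
    obtain ⟨a1, a2⟩ := hL1mem l hl
    rw [hwm l a1] at a2
    rw [hwm l a1, hψ, hφ]
    exact proj_inc p1 p2 e q _ _ _ hq a2 hed
  have hφinj : ∀ q q', plam p1 p2 q ≠ 0 → plam p1 p2 q' ≠ 0 → φ q = φ q' → q = q' := by
    intro q q' h h' heq
    rw [hφ] at heq
    exact Phi_inj p1 p2 e q q' h h' hed heq
  have hR0l : ∀ l ∈ L1, t + 2 ≤ (R0.filter (fun q => q ∈ l)).card := by
    intro l hl
    obtain ⟨a1, a2⟩ := hL1mem l hl
    have b1 := h2 l a1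
    have b2 := Finset.card_filter_add_card_filter_not (s := P0.filter (fun q => q ∈ l)) (fun q => plam p1 p2 q ≠ 0)
    have b3 : ((P0.filter (fun q => q ∈ l)).filter (fun q => ¬ plam p1 p2 q ≠ 0)).card ≤ 1 := by
      rw [Finset.card_le_one]
      intro x hx y hy
      rw [Finset.mem_filter, Finset.mem_filter, not_not, ← hl0mem] at hx hy
      by_contra hxy
      apply a2
      rw [line_unique (hL _ a1) hl0line hxy hx.1.2 hy.1.2 hx.2 hy.2]
      exact hp1l0
    have b4 : ((P0.filter (fun q => q ∈ l)).filter (fun q => plam p1 p2 q ≠ 0)).card ≤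
        (R0.filter (fun q => q ∈ l)).card := by
      refine Finset.card_le_card fun x hx => ?_
      rw [Finset.mem_filter, Finset.mem_filter] at hx
      rw [Finset.mem_filter, hR0, Finset.mem_filter]
      exact ⟨⟨hx.1.1, hx.2⟩, hx.1.2⟩
    have b5 : (P0.filter (fun q => q ∈ l)).card ≤ (R0.filter (fun q => q ∈ l)).card + 1 := by omega
    have b6 : ((P0.filter (fun q => q ∈ l)).card : ℝ) ≤ (R0.filter (fun q => q ∈ l)).card + 1 := by
      exact_mod_cast b5
    linarith
  have hψinj : ∀ l ∈ L1, ∀ l' ∈ L1, ψ l = ψ l' → l = l' := by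
    intro l hl l' hl' heq
    have b1 := hR0l l hl
    have b2 : 1 < (R0.filter (fun q => q ∈ l)).card := by
      have : (1 : ℝ) < (R0.filter (fun q => q ∈ l)).card := by linarith
      exact_mod_cast this
    obtain ⟨x, hx, y, hy, hxy⟩ := Finset.one_lt_card.mp b2
    rw [Finset.mem_filter] at hx hy
    have c1 := (hinc l hl x (hR0mem x hx.1).2).mpr hx.2
    have c2 := (hinc l hl y (hR0mem y hy.1).2).mpr hy.2
    rw [heq] at c1 c2
    exact line_unique (hL _ (hL1mem l hl).1) (hL _ (hL1mem l' hl').1) hxy hx.2 hy.2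
      ((hinc l' hl' x (hR0mem x hx.1).2).mp c1) ((hinc l' hl' y (hR0mem y hy.1).2).mp c2)
  have hdegU : ∀ q : F × F, ((L0.filter (fun l => q ∈ l)).card : ℝ) ≤ κ * M := by
    intro q
    have b1 := fan P0 (L0.filter (fun l => q ∈ l)) q t (by
      intro l hl
      rw [Finset.mem_filter] at hl
      exact ⟨hL l hl.1, hl.2, by have := h2 l hl.1; linarith⟩)
    have b2 : ((L0.filter (fun l => q ∈ l)).card : ℝ) * t ≤ M ^ 2 := by
      refine b1.trans (le_trans ?_ hPc)
      exact_mod_cast Finset.card_filter_le _ _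
    have b3 : M ^ 2 = κ * M * t := by rw [ht]; field_simp
    rw [b3] at b2
    exact le_of_mul_le_mul_right b2 ht0
  refine thmB hcard (P'.image φ) (R0.image φ) (L1.image ψ) κ M hκ hM hp ?_ ?_ ?_ ?_ ?_ ?_ ?_
  · refine le_trans (Nat.cast_le.mpr ?_) (hdegU p2)
    refine Finset.card_le_card_of_forall_subsingleton (fun a l => ∃ q ∈ P', q ∈ l ∧ (φ q).2 = a) ?_ ?_
    · intro a ha
      rw [Finset.mem_image] at ha
      obtain ⟨z, hz, rfl⟩ := ha
      rw [Finset.mem_image] at hz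
      obtain ⟨q, hq, rfl⟩ := hz
      obtain ⟨_, hq1, hq2, l1, hl1, l2, hl2, a1, a2, a3, a4, a5⟩ := hP'mem q hq
      exact ⟨l2, Finset.mem_filter.mpr ⟨hl2, a4⟩, q, hq, a3, rfl⟩
    · rintro l hl a ⟨_, q, hq, hql, rfl⟩ b ⟨_, q', hq', hql', rfl⟩
      rw [Finset.mem_filter] at hl
      rw [hφ]
      exact Phi_snd p1 p2 e q q' (hlam q hq) (hlam q' hq') l (hL l hl.1) hl.2 hql hql'
  · refine le_trans (Nat.cast_le.mpr ?_) (hdegU p1)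
    refine Finset.card_le_card_of_forall_subsingleton (fun a l => ∃ q ∈ P', q ∈ l ∧ (φ q).1 = a) ?_ ?_
    · intro a ha
      rw [Finset.mem_image] at ha
      obtain ⟨z, hz, rfl⟩ := ha
      rw [Finset.mem_image] at hz
      obtain ⟨q, hq, rfl⟩ := hz
      obtain ⟨_, hq1, hq2, l1, hl1, l2, hl2, a1, a2, a3, a4, a5⟩ := hP'mem q hq
      exact ⟨l1, Finset.mem_filter.mpr ⟨hl1, a2⟩, q, hq, a1, rfl⟩
    · rintro l hl a ⟨_, q, hq, hql, rfl⟩ b ⟨_, q', hq', hql', rfl⟩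
      rw [Finset.mem_filter] at hl
      rw [hφ]
      exact Phi_fst p1 p2 e q q' (hlam q hq) (hlam q' hq') l (hL l hl.1) hl.2 hql hql'
  · refine le_trans (Nat.cast_le.mpr ?_) hLc
    exact Finset.card_image_le.trans (Finset.card_filter_le _ _)
  · refine le_trans (Nat.cast_le.mpr ?_) hPc
    exact Finset.card_image_le.trans (Finset.card_filter_le _ _)
  · rw [Finset.card_image_of_injOn]
    · exact hP'card
    · intro q hq q' hq' h
      exact hφinj q q' (hlam q hq) (hlam q' hq') h
  · intro z hz
    rw [Finset.mem_image] at hz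
    obtain ⟨q, hq, rfl⟩ := hz
    obtain ⟨hqP, hq1, hq2, l1, hl1, l2, hl2, a1, a2, a3, a4, a5⟩ := hP'mem q hq
    have b1 : t + 2 ≤ ((L0.filter (fun l => q ∈ l)).erase l1).card :=
      card_erase_real _ _ _ (by have := h1 q hqP; linarith)
    have b2 : ((L0.filter (fun l => q ∈ l)).erase l1).card ≤
        ((L1.image ψ).filter (fun l : F × F => l.1 * (φ q).1 + l.2 = (φ q).2)).card := by
      have hmem : ∀ l ∈ (L0.filter (fun l => q ∈ l)).erase l1, l ∈ L1 ∧ q ∈ l := by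
        intro l hl
        rw [Finset.mem_erase, Finset.mem_filter] at hl
        refine ⟨Finset.mem_filter.mpr ⟨hl.2.1, fun hpl => ?_⟩, hl.2.2⟩
        exact hl.1 (line_unique (hL _ hl.2.1) (hL _ hl1) hq1 hpl hl.2.2 a2 a1)
      refine Finset.card_le_card_of_injOn ψ ?_ ?_
      · intro l hl
        obtain ⟨c1, c2⟩ := hmem l hl
        exact Finset.mem_coe.mpr (Finset.mem_filter.mpr ⟨Finset.mem_image_of_mem _ c1, (hinc l c1 q (hlam q hq)).mpr c2⟩)
      · intro l hl l' hl' h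
        exact hψinj l (hmem l hl).1 l' (hmem l' hl').1 h
    have b3 : (((L0.filter (fun l => q ∈ l)).erase l1).card : ℝ) ≤
        ((L1.image ψ).filter (fun l : F × F => l.1 * (φ q).1 + l.2 = (φ q).2)).card := by exact_mod_cast b2
    rw [← ht]
    linarith
  · intro z hz
    rw [Finset.mem_image] at hz
    obtain ⟨l, hl, rfl⟩ := hz
    have b1 := hR0l l hl
    have b2 : (R0.filter (fun q => q ∈ l)).card ≤
        ((R0.image φ).filter (fun q : F × F => (ψ l).1 * q.1 + (ψ l).2 = q.2)).card := by
      refine Finset.card_le_card_of_injOn φ ?_ ?_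
      · intro q hq
        obtain ⟨c1, c2⟩ := Finset.mem_filter.mp (Finset.mem_coe.mp hq)
        exact Finset.mem_coe.mpr (Finset.mem_filter.mpr ⟨Finset.mem_image_of_mem _ c1,
          (hinc l hl q (hR0mem q c1).2).mpr c2⟩)
      · intro q hq q' hq' h
        exact hφinj q q' (hR0mem q (Finset.mem_filter.mp (Finset.mem_coe.mp hq)).1).2
          (hR0mem q' (Finset.mem_filter.mp (Finset.mem_coe.mp hq')).1).2 h
    have b3 : ((R0.filter (fun q => q ∈ l)).card : ℝ) ≤
        ((R0.image φ).filter (fun q : F × F => (ψ l).1 * q.1 + (ψ l).2 = q.2)).card := by exact_mod_cast b2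
    rw [← ht]
    linarith


theorem thmD {F : Type*} [Field F] [Fintype F] {p : ℕ} [CharP F p] (hcard : Fintype.card F = p)
    (P : Finset (F × F)) (L : Finset (Set (F × F))) (κ M : ℝ) (hκ : 1 ≤ κ) (hM : 10 ^ 6 * κ ^ 39 ≤ M)
    (hp : M ^ 2 < p) (hL : ∀ l ∈ L, IsLine l)
    (hPc : (P.card : ℝ) ≤ M ^ 2) (hLc : (L.card : ℝ) ≤ M ^ 2) :
    (incidences P L : ℝ) ≤ 8 * (M ^ 3 / κ) := by
  by_contra! hcon
  have hκ0 : 0 < κ := by linarith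
  have hκ39 : κ ≤ κ ^ 39 := le_self_pow₀ hκ (by norm_num)
  have hM0 : 0 < M := by linarith
  have hMκ : 1 ≤ M / κ := by rw [le_div_iff₀ hκ0]; linarith
  have hI : incidences P L = ec (fun (q : F × F) (l : Set (F × F)) => q ∈ l) P L := by
    rw [ec_eq_card]; rfl
  rw [hI] at hcon
  obtain ⟨P0, hP0, L0, hL0, h1, h2, h3⟩ := prune (fun (q : F × F) (l : Set (F × F)) => q ∈ l) P L (M / κ + 3) (M / κ + 3)
  have a1 : (M / κ + 3) * P.card ≤ 4 * (M / κ) * M ^ 2 :=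
    mul_le_mul (by linarith) hPc (by positivity) (by positivity)
  have a2 : (M / κ + 3) * L.card ≤ 4 * (M / κ) * M ^ 2 :=
    mul_le_mul (by linarith) hLc (by positivity) (by positivity)
  have a3 : 4 * (M / κ) * M ^ 2 = 4 * (M ^ 3 / κ) := by ring
  have hne : P0.Nonempty := by
    rw [Finset.nonempty_iff_ne_empty]
    rintro rfl
    have b1 : ec (fun (q : F × F) (l : Set (F × F)) => q ∈ l) ∅ L0 = 0 := by unfold ec; simp
    rw [b1] at h3
    have b2 : 0 ≤ (M / κ + 3) * (L0.card : ℝ) := by positivity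
    have b3 : (M / κ + 3) * (((∅ : Finset (F × F)).card : ℕ) : ℝ) = 0 := by simp
    rw [b3] at h3
    push_cast at h3
    linarith
  refine thmC hcard P0 L0 κ M hκ hM hp (fun l hl => hL l (hL0 hl)) ?_ ?_ hne h1 h2
  · exact le_trans (by exact_mod_cast Finset.card_le_card hP0) hPc
  · exact le_trans (by exact_mod_cast Finset.card_le_card hL0) hLc

theorem stmt0 :
    ∀ ε : ℝ, 0 < ε → ∃ C : ℝ, 0 < C ∧
      ∀ p : ℕ, p.Prime → ∀ N : ℕ, N < p →
        ∀ (P : Finset (ZMod p × ZMod p)) (L : Finset (Set (ZMod p × ZMod p))),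
          (∀ l ∈ L, IsLine l) → P.card ≤ N → L.card ≤ N →
          (incidences P L : ℝ) ≤ C * (N : ℝ) ^ ((3 : ℝ) / 2 - 1 / 662 + ε) := by
  intro ε hε
  refine ⟨10 ^ 28, by norm_num, ?_⟩
  intro p hp N hN P L hL hPc hLc
  have hPr : (P.card : ℝ) ≤ N := by exact_mod_cast hPc
  have hLr : (L.card : ℝ) ≤ N := by exact_mod_cast hLc
  have htriv : (incidences P L : ℝ) ≤ (N : ℝ) * N := by
    have h1 : incidences P L ≤ P.card * L.card := by
      unfold incidences
      exact (Finset.card_filter_le _ _).trans (Finset.card_product _ _).le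
    have h2 : incidences P L ≤ N * N := h1.trans (Nat.mul_le_mul hPc hLc)
    exact_mod_cast h2
  rcases Nat.eq_zero_or_pos N with h0 | hpos
  · subst h0
    have h2 : (0 : ℝ) ≤ ((0 : ℕ) : ℝ) ^ ((3 : ℝ) / 2 - 1 / 662 + ε) := by positivity
    have h3 : ((0 : ℕ) : ℝ) * ((0 : ℕ) : ℝ) = 0 := by simp
    rw [h3] at htriv
    nlinarith
  have hN1 : (1 : ℝ) ≤ N := by exact_mod_cast hpos
  have hN0 : (0 : ℝ) < N := by linarith
  have hpow : (N : ℝ) ^ ((3 : ℝ) / 2 - 1 / 662) ≤ (N : ℝ) ^ ((3 : ℝ) / 2 - 1 / 662 + ε) :=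
    Real.rpow_le_rpow_of_exponent_le hN1 (by linarith)
  have hpow1 : 1 ≤ (N : ℝ) ^ ((3 : ℝ) / 2 - 1 / 662 + ε) :=
    Real.one_le_rpow hN1 (by linarith)
  by_cases hbig : (N : ℝ) < 10 ^ 14
  · have : (N : ℝ) * N ≤ 10 ^ 14 * 10 ^ 14 := by gcongr
    nlinarith
  push Not at hbig
  haveI : Fact p.Prime := ⟨hp⟩
  set κ := (N : ℝ) ^ ((1 : ℝ) / 662) with hκ
  set M := (N : ℝ) ^ ((1 : ℝ) / 2) with hM
  have hκ1 : 1 ≤ κ := Real.one_le_rpow hN1 (by norm_num)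
  have hM2 : M ^ 2 = N := by
    rw [hM, ← Real.rpow_natCast, ← Real.rpow_mul hN0.le]; norm_num
  have hMκ : 10 ^ 6 * κ ^ 39 ≤ M := by
    have e1 : (10 : ℝ) ^ 6 ≤ (N : ℝ) ^ ((3 : ℝ) / 7) := by
      calc (10 : ℝ) ^ 6 = ((10 : ℝ) ^ 14) ^ ((3 : ℝ) / 7) := by
            rw [← Real.rpow_natCast, ← Real.rpow_natCast, ← Real.rpow_mul (by norm_num)]; norm_num
        _ ≤ _ := Real.rpow_le_rpow (by norm_num) hbig (by norm_num)
    have e2 : κ ^ 39 = (N : ℝ) ^ ((39 : ℝ) / 662) := by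
      rw [hκ, ← Real.rpow_natCast, ← Real.rpow_mul hN0.le]; norm_num
    rw [e2]
    calc 10 ^ 6 * (N : ℝ) ^ ((39 : ℝ) / 662) ≤ (N : ℝ) ^ ((3 : ℝ) / 7) * (N : ℝ) ^ ((39 : ℝ) / 662) := by gcongr
      _ = (N : ℝ) ^ ((3 : ℝ) / 7 + (39 : ℝ) / 662) := (Real.rpow_add hN0 _ _).symm
      _ ≤ M := Real.rpow_le_rpow_of_exponent_le hN1 (by norm_num)
  have hfin := thmD (ZMod.card p) P L κ M hκ1 hMκ (by rw [hM2]; exact_mod_cast hN) hL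
    (by rw [hM2]; exact hPr) (by rw [hM2]; exact hLr)
  have hMk : M ^ 3 / κ = (N : ℝ) ^ ((3 : ℝ) / 2 - 1 / 662) := by
    rw [Real.rpow_sub hN0, hM, ← Real.rpow_natCast, ← Real.rpow_mul hN0.le]; norm_num [hκ]
  rw [hMk] at hfin
  have : 0 ≤ (N : ℝ) ^ ((3 : ℝ) / 2 - 1 / 662) := by positivity
  nlinarith
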